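/- Every affine Nash group G has a smallest normal Nash subgroup H such that some quotient of G by H is an almost linear affine Nash group; smallest means: some quotient of G by H is almost linear, and H is contained in every normal Nash subgroup K of G for which some quotient of G by K is almost linear. -/

import Mathlib

open Set

/-- A basic semialgebraic subset of `ℝⁿ`, given by one polynomial equation
`p = 0` and finitely many polynomial inequalities `g > 0`. -/
def BasicSemialgebraic {n : ℕ} (p : MvPolynomial (Fin n) ℝ)
    (gs : List (MvPolynomial (Fin n) ℝ)) : Set (Fin n → ℝ) :=
  {x | MvPolynomial.eval x p = 0 ∧ ∀ g ∈ gs, 0 < MvPolynomial.eval x g}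

/-- A subset of `ℝⁿ` is semialgebraic if it is a finite union of finite
intersections of basic semialgebraic sets. -/
def IsSemialgebraic {n : ℕ} (S : Set (Fin n → ℝ)) : Prop :=
  ∃ L : List (List (MvPolynomial (Fin n) ℝ × List (MvPolynomial (Fin n) ℝ))),
    S = ⋃ c ∈ L, ⋂ b ∈ c, BasicSemialgebraic b.1 b.2

/-- `S` is a `d`-dimensional real analytic submanifold of `ℝⁿ`: around each of
its points there is an analytic chart of `ℝⁿ` flattening `S` onto the first `d`
coordinates. -/
def IsAnalyticSubmanifold {n : ℕ} (d : ℕ) (S : Set (Fin n → ℝ)) : Prop :=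
  ∀ x ∈ S, ∃ (U V : Set (Fin n → ℝ)) (φ ψ : (Fin n → ℝ) → (Fin n → ℝ)),
    IsOpen U ∧ IsOpen V ∧ x ∈ U ∧
    AnalyticOnNhd ℝ φ U ∧ AnalyticOnNhd ℝ ψ V ∧
    (∀ y ∈ U, φ y ∈ V) ∧ (∀ y ∈ V, ψ y ∈ U) ∧
    (∀ y ∈ U, ψ (φ y) = y) ∧ (∀ y ∈ V, φ (ψ y) = y) ∧
    φ '' (U ∩ S) = V ∩ {y | ∀ i : Fin n, d ≤ (i : ℕ) → y i = 0}

/-- `f` is real analytic on `S`: near each point of `S` it is the restriction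
of a real analytic map defined on an open set. -/
def LocAnalyticOn {n m : ℕ} (S : Set (Fin n → ℝ)) (f : (Fin n → ℝ) → (Fin m → ℝ)) : Prop :=
  ∀ x ∈ S, ∃ U : Set (Fin n → ℝ), IsOpen U ∧ x ∈ U ∧
    ∃ g : (Fin n → ℝ) → (Fin m → ℝ), AnalyticOnNhd ℝ g U ∧ ∀ y ∈ U ∩ S, g y = f y

/-- The graph of `f` restricted to `S`, as a subset of `ℝ^(n+m)`. -/
def NashGraph {n m : ℕ} (S : Set (Fin n → ℝ)) (f : (Fin n → ℝ) → (Fin m → ℝ)) :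
    Set (Fin (n + m) → ℝ) :=
  {z | ∃ x ∈ S, z = Fin.append x (f x)}

/-- A Nash mapping on `S`: real analytic with semialgebraic graph. -/
def IsNashMapOn {n m : ℕ} (S : Set (Fin n → ℝ)) (f : (Fin n → ℝ) → (Fin m → ℝ)) : Prop :=
  LocAnalyticOn S f ∧ IsSemialgebraic (NashGraph S f)

/-- First `n` coordinates of a point of `ℝ^(n+m)`. -/
def frontHalf {n m : ℕ} (z : Fin (n + m) → ℝ) : Fin n → ℝ := fun i => z (Fin.castAdd m i)

/-- Last `m` coordinates of a point of `ℝ^(n+m)`. -/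
def backHalf {n m : ℕ} (z : Fin (n + m) → ℝ) : Fin m → ℝ := fun i => z (Fin.natAdd n i)

/-- An affine Nash group: a semialgebraic analytic submanifold of some `ℝⁿ`
together with a group structure whose multiplication and inversion are Nash
mappings. -/
structure NashGroup where
  n : ℕ
  dim : ℕ
  carrier : Set (Fin n → ℝ)
  semialg : IsSemialgebraic carrier
  submanifold : IsAnalyticSubmanifold dim carrier
  one : Fin n → ℝ
  mul : (Fin n → ℝ) → (Fin n → ℝ) → (Fin n → ℝ)
  inv : (Fin n → ℝ) → (Fin n → ℝ)
  one_mem : one ∈ carrier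
  mul_mem : ∀ x ∈ carrier, ∀ y ∈ carrier, mul x y ∈ carrier
  inv_mem : ∀ x ∈ carrier, inv x ∈ carrier
  mul_assoc : ∀ x ∈ carrier, ∀ y ∈ carrier, ∀ z ∈ carrier,
    mul (mul x y) z = mul x (mul y z)
  one_mul : ∀ x ∈ carrier, mul one x = x
  mul_one : ∀ x ∈ carrier, mul x one = x
  inv_mul_cancel : ∀ x ∈ carrier, mul (inv x) x = one
  mul_nash : IsNashMapOn {z : Fin (n + n) → ℝ | frontHalf z ∈ carrier ∧ backHalf z ∈ carrier}
      (fun z => mul (frontHalf z) (backHalf z))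
  inv_nash : IsNashMapOn carrier inv

/-- A Nash subgroup of an affine Nash group: a subgroup which is a
semialgebraic subset. -/
structure IsNashSubgroup (G : NashGroup) (H : Set (Fin G.n → ℝ)) : Prop where
  subset : H ⊆ G.carrier
  one_mem : G.one ∈ H
  mul_mem : ∀ x ∈ H, ∀ y ∈ H, G.mul x y ∈ H
  inv_mem : ∀ x ∈ H, G.inv x ∈ H
  semialg : IsSemialgebraic H

/-- `N` is a normal subset of the subgroup `K` of `G`. -/
def IsNormalIn (G : NashGroup) (K N : Set (Fin G.n → ℝ)) : Prop :=
  ∀ g ∈ K, ∀ x ∈ N, G.mul (G.mul g x) (G.inv g) ∈ N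

/-- A Nash homomorphism defined on the subgroup `H` of `G`, with values in the
affine Nash group `Q`. -/
structure IsNashHomOn (G : NashGroup) (H : Set (Fin G.n → ℝ)) (Q : NashGroup)
    (f : (Fin G.n → ℝ) → (Fin Q.n → ℝ)) : Prop where
  mapsTo : ∀ x ∈ H, f x ∈ Q.carrier
  map_mul : ∀ x ∈ H, ∀ y ∈ H, f (G.mul x y) = Q.mul (f x) (f y)
  nash : IsNashMapOn H f

/-- Flattening of a square matrix to a point of `ℝ^(m*m)`. -/
def matFlatten {m : ℕ} (A : Matrix (Fin m) (Fin m) ℝ) : Fin (m * m) → ℝ :=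
  fun k => A (finProdFinEquiv.symm k).1 (finProdFinEquiv.symm k).2

/-- The subgroup `H` of `G` is almost linear: it admits a Nash homomorphism
with finite kernel into `GL(m, ℝ)` for some `m`. -/
def AlmostLinearOn (G : NashGroup) (H : Set (Fin G.n → ℝ)) : Prop :=
  ∃ (m : ℕ) (f : (Fin G.n → ℝ) → Matrix (Fin m) (Fin m) ℝ),
    IsNashMapOn H (fun x => matFlatten (f x)) ∧
    (∀ x ∈ H, IsUnit (f x)) ∧
    (∀ x ∈ H, ∀ y ∈ H, f (G.mul x y) = f x * f y) ∧
    Set.Finite {x ∈ H | f x = 1}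

/-- An affine Nash group is almost linear if it admits a Nash homomorphism
with finite kernel into some `GL(m, ℝ)`. -/
def NashGroup.AlmostLinear (G : NashGroup) : Prop := AlmostLinearOn G G.carrier

/-- `Q` is a quotient of the subgroup `H` of `G` by a normal Nash subgroup:
there are a normal Nash subgroup `N` of `H` and a surjective Nash homomorphism
`H → Q` with kernel `N`. -/
def IsQuotientOf (G : NashGroup) (H : Set (Fin G.n → ℝ)) (Q : NashGroup) : Prop :=
  ∃ (N : Set (Fin G.n → ℝ)) (π : (Fin G.n → ℝ) → (Fin Q.n → ℝ)),
    IsNashSubgroup G N ∧ N ⊆ H ∧ IsNormalIn G H N ∧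
    IsNashHomOn G H Q π ∧ π '' H = Q.carrier ∧ {x ∈ H | π x = Q.one} = N

/-- The subgroup `H` of `G` is anti-linear: it has no quotient which is an
almost linear affine Nash group of positive dimension. -/
def AntiLinearOn (G : NashGroup) (H : Set (Fin G.n → ℝ)) : Prop :=
  ∀ Q : NashGroup, IsQuotientOf G H Q → Q.AlmostLinear → Q.dim = 0

/-- The subgroup `H` of `G` is toroidal: connected and anti-linear. -/
def ToroidalOn (G : NashGroup) (H : Set (Fin G.n → ℝ)) : Prop :=
  IsConnected H ∧ AntiLinearOn G H

/-- A toroidal affine Nash group: connected and anti-linear. -/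
def NashGroup.Toroidal (G : NashGroup) : Prop := ToroidalOn G G.carrier

/-- An affine Nash group is complete if it has no nontrivial connected almost
linear Nash subgroup. -/
def NashGroup.Complete (G : NashGroup) : Prop :=
  ∀ H, IsNashSubgroup G H → IsConnected H → AlmostLinearOn G H → H = {G.one}

/-- An abelian Nash manifold: a connected complete affine Nash group. -/
def AbelianNashManifold (G : NashGroup) : Prop := IsConnected G.carrier ∧ G.Complete

/-- Some quotient of `G` by `N` is an almost linear affine Nash group. -/
def HasAlmostLinearQuotientBy (G : NashGroup) (N : Set (Fin G.n → ℝ)) : Prop :=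
  ∃ (Q : NashGroup) (π : (Fin G.n → ℝ) → (Fin Q.n → ℝ)),
    IsNashHomOn G G.carrier Q π ∧ π '' G.carrier = Q.carrier ∧
    {x ∈ G.carrier | π x = Q.one} = N ∧ Q.AlmostLinear

open scoped Topology

/-! ### Order automorphisms of the line matching the signs of functions -/

theorem sign_eq_of_forall_ne_zero {f : ℝ → ℝ} (hf : Continuous f) {a b : ℝ}
    (h : ∀ t ∈ uIcc a b, f t ≠ 0) : SignType.sign (f a) = SignType.sign (f b) := by
  have hz : (0 : ℝ) ∉ uIcc (f a) (f b) := fun h0 => by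
    obtain ⟨t, ht, ht0⟩ := intermediate_value_uIcc hf.continuousOn h0
    exact h t ht ht0
  rw [mem_uIcc, not_or, not_and_or, not_and_or] at hz
  rcases lt_trichotomy (f a) 0 with ha | ha | ha
  · rw [sign_neg ha, sign_neg]
    by_contra hb
    rcases hz.1 with h | h <;> linarith
  · exact absurd ha (h a left_mem_uIcc)
  · rw [sign_pos ha, sign_pos]
    by_contra hb
    rcases hz.2 with h | h <;> linarith

/-- An order automorphism of the line supported in `(a, b)` and moving `u` to `v`. -/
theorem exists_orderIso_moving {a b u v : ℝ} (hu : u ∈ Ioo a b) (hv : v ∈ Ioo a b) :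
    ∃ k : ℝ ≃o ℝ, k u = v ∧ ∀ s, s ∉ Ioo a b → k s = s := by
  obtain ⟨hau, hub⟩ := hu
  obtain ⟨hav, hvb⟩ := hv
  set T : ℝ → ℝ := fun s => max 0 (min ((s - a) / (u - a)) ((b - s) / (b - u))) with hT
  have hua : 0 < u - a := by linarith
  have hbu : 0 < b - u := by linarith
  have hT0 : ∀ s, 0 ≤ T s := fun s => le_max_left _ _
  have hT1 : ∀ s, T s ≤ 1 := by
    intro s
    refine max_le zero_le_one ?_
    rcases le_total s u with h | h
    · exact (min_le_left _ _).trans ((div_le_one hua).2 (by linarith))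
    · exact (min_le_right _ _).trans ((div_le_one hbu).2 (by linarith))
  have hup : ∀ s t, s ≤ t → T t ≤ T s + (t - s) / (u - a) := by
    intro s t hst
    have h0 : 0 ≤ (t - s) / (u - a) := div_nonneg (by linarith) hua.le
    refine max_le (add_nonneg (hT0 s) h0) ?_
    have h1 : (t - a) / (u - a) = (s - a) / (u - a) + (t - s) / (u - a) := by ring
    have h2 : (b - t) / (b - u) ≤ (b - s) / (b - u) :=
      div_le_div_of_nonneg_right (by linarith) hbu.le
    have h3 : min ((s - a) / (u - a)) ((b - s) / (b - u)) ≤ T s := le_max_right _ _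
    rcases min_cases ((s - a) / (u - a)) ((b - s) / (b - u)) with ⟨h4, _⟩ | ⟨h4, _⟩
    · exact (min_le_left _ _).trans (by linarith)
    · exact (min_le_right _ _).trans (by linarith)
  have hdown : ∀ s t, s ≤ t → T s ≤ T t + (t - s) / (b - u) := by
    intro s t hst
    have h0 : 0 ≤ (t - s) / (b - u) := div_nonneg (by linarith) hbu.le
    refine max_le (add_nonneg (hT0 t) h0) ?_
    have h1 : (b - s) / (b - u) = (b - t) / (b - u) + (t - s) / (b - u) := by ring
    have h2 : (s - a) / (u - a) ≤ (t - a) / (u - a) :=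
      div_le_div_of_nonneg_right (by linarith) hua.le
    have h3 : min ((t - a) / (u - a)) ((b - t) / (b - u)) ≤ T t := le_max_right _ _
    rcases min_cases ((t - a) / (u - a)) ((b - t) / (b - u)) with ⟨h4, _⟩ | ⟨h4, _⟩
    · exact (min_le_left _ _).trans (by linarith)
    · exact (min_le_right _ _).trans (by linarith)
  have hmono : StrictMono fun s => s + (v - u) * T s := by
    intro s t hst
    have hd : 0 < t - s := by linarith
    show s + (v - u) * T s < t + (v - u) * T t
    rcases le_total u v with huv | huv
    · have h1 := mul_le_mul_of_nonneg_left (hdown s t hst.le) (sub_nonneg.2 huv)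
      have h2 : (v - u) * ((t - s) / (b - u)) < t - s := by
        rw [mul_div_assoc', div_lt_iff₀ hbu, mul_comm]
        exact mul_lt_mul_of_pos_left (by linarith) hd
      linarith [mul_add (v - u) (T t) ((t - s) / (b - u))]
    · have h1 := mul_le_mul_of_nonneg_left (hup s t hst.le) (sub_nonneg.2 huv)
      have h2 : (u - v) * ((t - s) / (u - a)) < t - s := by
        rw [mul_div_assoc', div_lt_iff₀ hua, mul_comm]
        exact mul_lt_mul_of_pos_left (by linarith) hd
      linarith [mul_add (u - v) (T s) ((t - s) / (u - a))]
  have hcont : Continuous fun s => s + (v - u) * T s := by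
    simp only [hT]
    fun_prop
  have hsurj : Function.Surjective fun s => s + (v - u) * T s := by
    intro y
    have hbd : ∀ s, |(v - u) * T s| ≤ |v - u| := fun s => by
      rw [abs_mul, abs_of_nonneg (hT0 s)]
      exact mul_le_of_le_one_right (abs_nonneg _) (hT1 s)
    refine mem_range_of_exists_le_of_exists_ge hcont ⟨y - |v - u|, ?_⟩ ⟨y + |v - u|, ?_⟩
    · linarith [(abs_le.1 (hbd (y - |v - u|))).2]
    · linarith [(abs_le.1 (hbd (y + |v - u|))).1]
  refine ⟨hmono.orderIsoOfSurjective _ hsurj, ?_, ?_⟩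
  · show u + (v - u) * T u = v
    have : T u = 1 := by simp [hT, hua.ne', hbu.ne']
    rw [this]; ring
  · intro s hs
    show s + (v - u) * T s = s
    have : T s = 0 := by
      refine le_antisymm (max_le le_rfl ?_) (hT0 s)
      rcases le_or_gt s a with h | h
      · exact (min_le_left _ _).trans (div_nonpos_of_nonpos_of_nonneg (by linarith) hua.le)
      · have : b ≤ s := not_lt.1 fun hb => hs ⟨h, hb⟩
        exact (min_le_right _ _).trans (div_nonpos_of_nonpos_of_nonneg (by linarith) hbu.le)
    rw [this]; ring

theorem forall_lt_or_forall_gt_or_exists_consecutive (Z : Finset ℝ) {s : ℝ} (hs : s ∉ Z) :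
    (∀ z ∈ Z, s < z) ∨ (∀ z ∈ Z, z < s) ∨
      ∃ a ∈ Z, ∃ b ∈ Z, s ∈ Ioo a b ∧ ∀ z ∈ Z, z ∉ Ioo a b := by
  classical
  have hne : ∀ z ∈ Z, z ≠ s := fun z hz h => hs (h ▸ hz)
  rcases (Z.filter (· < s)).eq_empty_or_nonempty with h1 | h1
  · left
    intro z hz
    have := Finset.filter_eq_empty_iff.1 h1 hz
    exact lt_of_le_of_ne (not_lt.1 this) (hne z hz).symm
  rcases (Z.filter (s < ·)).eq_empty_or_nonempty with h2 | h2
  · right; left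
    intro z hz
    have := Finset.filter_eq_empty_iff.1 h2 hz
    exact lt_of_le_of_ne (not_lt.1 this) (hne z hz)
  right; right
  have ha := Finset.mem_filter.1 (Finset.max'_mem _ h1)
  have hb := Finset.mem_filter.1 (Finset.min'_mem _ h2)
  refine ⟨_, ha.1, _, hb.1, ⟨ha.2, hb.2⟩, fun z hz hzab => ?_⟩
  rcases lt_or_gt_of_ne (hne z hz) with h | h
  · exact absurd (Finset.le_max' _ z (Finset.mem_filter.2 ⟨hz, h⟩)) (not_le.2 hzab.1)
  · exact absurd (Finset.min'_le _ z (Finset.mem_filter.2 ⟨hz, h⟩)) (not_le.2 hzab.2)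

section InjOn

variable {f : ℝ → ℝ} {a b c s : ℝ}

theorem sign_eq_right_of_injOn (hf : Continuous f) (hi : InjOn f (Icc a b)) (hc : f c = 0)
    (hac : a ≤ c) (hcs : c < s) (hsb : s ≤ b) :
    SignType.sign (f s) = SignType.sign (f b) := by
  refine sign_eq_of_forall_ne_zero hf fun t ht ht0 => ?_
  rw [uIcc_of_le hsb] at ht
  have := hi ⟨by linarith [ht.1], ht.2⟩ ⟨hac, by linarith⟩ (ht0.trans hc.symm)
  linarith [ht.1]

theorem sign_eq_left_of_injOn (hf : Continuous f) (hi : InjOn f (Icc a b)) (hc : f c = 0)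
    (hcb : c ≤ b) (hsc : s < c) (has : a ≤ s) :
    SignType.sign (f s) = SignType.sign (f a) := by
  refine sign_eq_of_forall_ne_zero hf fun t ht ht0 => ?_
  rw [uIcc_of_ge has] at ht
  have := hi ⟨ht.1, by linarith [ht.2]⟩ ⟨by linarith, hcb⟩ (ht0.trans hc.symm)
  linarith [ht.2]

theorem mul_neg_of_injOn (hf : Continuous f) (hi : InjOn f (Icc a b)) (hc : f c = 0)
    (hac : c ∈ Ioo a b) : f a * f b < 0 := by
  have hab : a ≤ b := (hac.1.trans hac.2).le
  rcases hf.continuousOn.strictMonoOn_of_injOn_Icc' hab hi with h | h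
  · have h1 := h (left_mem_Icc.2 hab) ⟨hac.1.le, hac.2.le⟩ hac.1
    have h2 := h ⟨hac.1.le, hac.2.le⟩ (right_mem_Icc.2 hab) hac.2
    exact mul_neg_of_neg_of_pos (hc ▸ h1) (hc ▸ h2)
  · have h1 := h (left_mem_Icc.2 hab) ⟨hac.1.le, hac.2.le⟩ hac.1
    have h2 := h ⟨hac.1.le, hac.2.le⟩ (right_mem_Icc.2 hab) hac.2
    exact mul_neg_of_pos_of_neg (hc ▸ h1) (hc ▸ h2)

theorem exists_root_of_mul_neg (hf : Continuous f) (hab : a ≤ b) (h : f a * f b < 0) :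
    ∃ c ∈ Ioo a b, f c = 0 := by
  have h0 : (0 : ℝ) ∈ uIcc (f a) (f b) := by
    rw [mem_uIcc]
    rcases mul_neg_iff.1 h with h | h
    · exact Or.inr ⟨h.2.le, h.1.le⟩
    · exact Or.inl ⟨h.1.le, h.2.le⟩
  obtain ⟨c, hc, hc0⟩ := intermediate_value_uIcc hf.continuousOn h0
  rw [uIcc_of_le hab] at hc
  refine ⟨c, ⟨lt_of_le_of_ne hc.1 ?_, lt_of_le_of_ne hc.2 ?_⟩, hc0⟩
  · rintro rfl; simp [hc0] at h
  · rintro rfl; simp [hc0] at h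

end InjOn

theorem mul_neg_of_sign_eq {a b c d : ℝ} (h1 : SignType.sign a = SignType.sign c)
    (h2 : SignType.sign b = SignType.sign d) (h : a * b < 0) : c * d < 0 := by
  rw [← sign_eq_neg_one_iff, sign_mul, ← h1, ← h2, ← sign_mul, sign_eq_neg_one_iff]
  exact h

theorem exists_orderIso_sign_eq {P q : ℝ → ℝ} (hP : Continuous P) (hq : Continuous q)
    (Z : Finset ℝ)
    (hPi : ∀ a ∈ Z, ∀ b ∈ Z, (∀ z ∈ Z, z ∉ Ioo a b) → InjOn P (Icc a b))
    (hqi : ∀ a ∈ Z, ∀ b ∈ Z, (∀ z ∈ Z, z ∉ Ioo a b) → InjOn q (Icc a b))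
    (hZ : ∀ z ∈ Z, SignType.sign (P z) = SignType.sign (q z))
    (hlow : ∀ s s', (∀ z ∈ Z, s < z) → (∀ z ∈ Z, s' < z) →
      P s ≠ 0 ∧ SignType.sign (P s) = SignType.sign (q s'))
    (hhigh : ∀ s s', (∀ z ∈ Z, z < s) → (∀ z ∈ Z, z < s') →
      P s ≠ 0 ∧ SignType.sign (P s) = SignType.sign (q s'))
    (hfin : {s | P s = 0}.Finite) :
    ∃ k : ℝ ≃o ℝ, (∀ z ∈ Z, k z = z) ∧ ∀ s, SignType.sign (P s) = SignType.sign (q (k s)) := by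
  classical
  have key : ∀ R : Finset ℝ, (∀ c ∈ R, P c = 0) →
      ∃ k : ℝ ≃o ℝ, (∀ z ∈ Z, k z = z) ∧ ∀ c ∈ R, q (k c) = 0 := by
    intro R
    induction R using Finset.induction_on with
    | empty => exact fun _ => ⟨OrderIso.refl ℝ, fun z _ => rfl, by simp⟩
    | insert c R hcR ih =>
      intro hR
      obtain ⟨k, hkZ, hkR⟩ := ih fun c hc => hR c (Finset.mem_insert_of_mem hc)
      have hc0 : P c = 0 := hR c (Finset.mem_insert_self _ _)
      by_cases hcZ : c ∈ Z
      · refine ⟨k, hkZ, fun d hd => ?_⟩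
        rcases Finset.mem_insert.1 hd with rfl | hd
        · rw [hkZ d hcZ, ← sign_eq_zero_iff, ← hZ d hcZ, hc0, sign_zero]
        · exact hkR d hd
      rcases forall_lt_or_forall_gt_or_exists_consecutive Z hcZ with h | h | h
      · exact absurd hc0 (hlow c c h h).1
      · exact absurd hc0 (hhigh c c h h).1
      obtain ⟨a, ha, b, hb, hcab, hab⟩ := h
      have hneg := mul_neg_of_sign_eq (hZ a ha) (hZ b hb)
        (mul_neg_of_injOn hP (hPi a ha b hb hab) hc0 hcab)
      obtain ⟨c', hc', hqc'⟩ := exists_root_of_mul_neg hq (hcab.1.trans hcab.2).le hneg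
      have hkab : ∀ s, k s ∈ Ioo a b ↔ s ∈ Ioo a b := fun s => by
        conv_lhs => rw [← hkZ a ha, ← hkZ b hb]
        simp [mem_Ioo]
      obtain ⟨m, hm, hm'⟩ := exists_orderIso_moving ((hkab c).2 hcab) hc'
      refine ⟨k.trans m, fun z hz => ?_, fun d hd => ?_⟩
      · rw [OrderIso.trans_apply, hkZ z hz, hm' z (hab z hz)]
      · rcases Finset.mem_insert.1 hd with rfl | hdR
        · rw [OrderIso.trans_apply, hm, hqc']
        · rw [OrderIso.trans_apply, hm', hkR d hdR]
          intro hd'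
          rw [hkab] at hd'
          have := hPi a ha b hb hab (Ioo_subset_Icc_self hd') (Ioo_subset_Icc_self hcab)
            ((hR d hd).trans hc0.symm)
          exact hcR (this ▸ hdR)
  obtain ⟨k, hkZ, hkR⟩ := key hfin.toFinset (by simp)
  refine ⟨k, hkZ, fun s => ?_⟩
  by_cases hsZ : s ∈ Z
  · rw [hkZ s hsZ, hZ s hsZ]
  rcases forall_lt_or_forall_gt_or_exists_consecutive Z hsZ with h | h | h
  · refine (hlow s (k s) h fun z hz => ?_).2
    rw [← hkZ z hz]; exact k.lt_iff_lt.2 (h z hz)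
  · refine (hhigh s (k s) h fun z hz => ?_).2
    rw [← hkZ z hz]; exact k.lt_iff_lt.2 (h z hz)
  obtain ⟨a, ha, b, hb, hs, hab⟩ := h
  have hab' : a < b := hs.1.trans hs.2
  have hks : k s ∈ Ioo a b := by
    rw [← hkZ a ha, ← hkZ b hb]
    exact ⟨k.lt_iff_lt.2 hs.1, k.lt_iff_lt.2 hs.2⟩
  have hPab := hPi a ha b hb hab
  have hqab := hqi a ha b hb hab
  by_cases hroot : ∃ c ∈ Ioo a b, P c = 0
  · obtain ⟨c, hc, hc0⟩ := hroot
    have hqc : q (k c) = 0 := hkR c (by simpa using hc0)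
    have hkc : k c ∈ Ioo a b := by
      rw [← hkZ a ha, ← hkZ b hb]
      exact ⟨k.lt_iff_lt.2 hc.1, k.lt_iff_lt.2 hc.2⟩
    rcases lt_trichotomy s c with h | rfl | h
    · rw [sign_eq_left_of_injOn hP hPab hc0 hc.2.le h hs.1.le,
        sign_eq_left_of_injOn hq hqab hqc hkc.2.le (k.lt_iff_lt.2 h) hks.1.le, hZ a ha]
    · rw [hc0, hqc]
    · rw [sign_eq_right_of_injOn hP hPab hc0 hc.1.le h hs.2.le,
        sign_eq_right_of_injOn hq hqab hqc hkc.1.le (k.lt_iff_lt.2 h) hks.2.le, hZ b hb]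
  · have hrootq : ∀ c ∈ Ioo a b, q c ≠ 0 := fun c hc hc0 => hroot <|
      exists_root_of_mul_neg hP hab'.le
        (mul_neg_of_sign_eq (hZ a ha).symm (hZ b hb).symm (mul_neg_of_injOn hq hqab hc0 hc))
    have hrootP : ∀ c ∈ Ioo a b, P c ≠ 0 := fun c hc hc0 => hroot ⟨c, hc, hc0⟩
    by_cases ha0 : P a = 0
    · have hqa0 : q a = 0 := by rw [← sign_eq_zero_iff, ← hZ a ha, ha0, sign_zero]
      rw [sign_eq_right_of_injOn hP hPab ha0 le_rfl hs.1 hs.2.le,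
        sign_eq_right_of_injOn hq hqab hqa0 le_rfl hks.1 hks.2.le, hZ b hb]
    · have hqa0 : q a ≠ 0 := by rwa [← sign_ne_zero, ← hZ a ha, sign_ne_zero]
      have aux : ∀ f : ℝ → ℝ, Continuous f → f a ≠ 0 → (∀ c ∈ Ioo a b, f c ≠ 0) →
          ∀ t ∈ Ioo a b, SignType.sign (f a) = SignType.sign (f t) := by
        intro f hf hfa hfr t ht
        refine sign_eq_of_forall_ne_zero hf fun r hr => ?_
        rw [uIcc_of_le ht.1.le] at hr
        rcases hr.1.eq_or_lt with rfl | h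
        · exact hfa
        · exact hfr r ⟨h, hr.2.trans_lt ht.2⟩
      rw [← aux P hP ha0 hrootP s hs, ← aux q hq hqa0 hrootq _ hks, hZ a ha]

/-- If `k` fixes every zero of `f`, then it preserves the sign of `f`. -/
theorem sign_comp_orderIso_of_fixes_roots {f : ℝ → ℝ} (hf : Continuous f) (k : ℝ ≃o ℝ)
    (hk : ∀ z, f z = 0 → k z = z) (s : ℝ) : SignType.sign (f (k s)) = SignType.sign (f s) := by
  by_cases hs : f s = 0
  · rw [hk s hs]
  refine sign_eq_of_forall_ne_zero hf fun z hz hz0 => ?_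
  have hkz := hk z hz0
  have hzs : z ≠ s := by rintro rfl; exact hs hz0
  rcases mem_uIcc.1 hz with h | h
  · have := k.lt_iff_lt.2 (lt_of_le_of_ne h.2 hzs)
    linarith
  · have := k.lt_iff_lt.2 (lt_of_le_of_ne h.1 hzs.symm)
    linarith

/-! ### Sign matching for families of polynomials in one variable -/

section Univariate

open Polynomial Filter

theorem Polynomial.eventually_atTop_sign_eval {p : ℝ[X]} (hp : 0 < p.natDegree) :
    ∀ᶠ t in atTop, SignType.sign (p.eval t) = SignType.sign p.leadingCoeff := by
  have hd : 0 < p.degree := natDegree_pos_iff_degree_pos.1 hp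
  have h0 : p.leadingCoeff ≠ 0 := by
    rw [Ne, leadingCoeff_eq_zero]
    rintro rfl
    simp at hp
  rcases lt_or_gt_of_ne h0 with h | h
  · filter_upwards [(p.tendsto_atBot_of_leadingCoeff_nonpos hd h.le).eventually_lt_atBot 0]
      with t ht
    rw [sign_neg ht, sign_neg h]
  · filter_upwards [(p.tendsto_atTop_of_leadingCoeff_nonneg hd h.le).eventually_gt_atTop 0]
      with t ht
    rw [sign_pos ht, sign_pos h]

theorem Polynomial.eventually_atBot_sign_eval {p : ℝ[X]} (hp : 0 < p.natDegree) :
    ∀ᶠ t in atBot, SignType.sign (p.eval t) =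
      SignType.sign p.leadingCoeff * SignType.sign ((-1 : ℝ) ^ p.natDegree) := by
  have hd : (p.comp (-X)).natDegree = p.natDegree := by simp [natDegree_comp]
  have := tendsto_neg_atBot_atTop.eventually (eventually_atTop_sign_eval (hd.symm ▸ hp))
  filter_upwards [this] with t ht
  rw [leadingCoeff_comp (by simp), eval_comp] at ht
  simpa [sign_mul] using ht

theorem Polynomial.injOn_Icc_of_derivative_ne_zero {p : ℝ[X]} {a b : ℝ}
    (h : ∀ t ∈ Ioo a b, p.derivative.eval t ≠ 0) : InjOn (fun t => p.eval t) (Icc a b) := by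
  have key : ∀ u ∈ Icc a b, ∀ v ∈ Icc a b, u < v → p.eval u ≠ p.eval v := by
    intro u hu v hv huv he
    obtain ⟨c, hc, hc0⟩ := exists_deriv_eq_zero (f := fun t => p.eval t) huv
      p.continuous.continuousOn he
    rw [Polynomial.deriv] at hc0
    exact h c ⟨hu.1.trans_lt hc.1, hc.2.trans_le hv.2⟩ hc0
  intro u hu v hv he
  by_contra hne
  rcases lt_or_gt_of_ne hne with h | h
  · exact key u hu v hv h he
  · exact key v hv u hu h he.symm

theorem Polynomial.exists_orderIso_sign_eval_insert {ι : Type*} [Finite ι] {b b' : ι → ℝ[X]}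
    {h : ℝ ≃o ℝ}
    (hb : ∀ i t, SignType.sign ((b i).eval t) = SignType.sign ((b' i).eval (h t)))
    {p q : ℝ[X]} {j : ι} (hj : b j = derivative p) (hj' : b' j = derivative q)
    (hroots : ∀ i t, b i ≠ 0 → (b i).eval t = 0 →
      SignType.sign (p.eval t) = SignType.sign (q.eval (h t)))
    (hdeg : p.natDegree = q.natDegree)
    (hlc : SignType.sign p.leadingCoeff = SignType.sign q.leadingCoeff) :
    ∃ h' : ℝ ≃o ℝ,
      (∀ i t, SignType.sign ((b i).eval t) = SignType.sign ((b' i).eval (h' t))) ∧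
      ∀ t, SignType.sign (p.eval t) = SignType.sign (q.eval (h' t)) := by
  classical
  cases nonempty_fintype ι
  rcases Nat.eq_zero_or_pos p.natDegree with hp | hp
  · refine ⟨h, hb, fun t => ?_⟩
    rw [leadingCoeff, leadingCoeff, ← hdeg, hp] at hlc
    rw [eq_C_of_natDegree_eq_zero hp,
      eq_C_of_natDegree_eq_zero (show q.natDegree = 0 from hdeg ▸ hp), eval_C, eval_C, hlc]
  have hq : 0 < q.natDegree := hdeg ▸ hp
  have hp0 : p ≠ 0 := by rintro rfl; simp at hp
  have hlc0 : SignType.sign p.leadingCoeff ≠ 0 := by simpa [sign_eq_zero_iff] using hp0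
  have hbne : ∀ i, b i = 0 ↔ b' i = 0 := by
    intro i
    constructor
    · intro h0
      refine Polynomial.funext fun t => ?_
      have := hb i (h.symm t)
      simp only [h0, eval_zero, sign_zero, OrderIso.apply_symm_apply] at this
      simpa using (sign_eq_zero_iff.1 this.symm)
    · intro h0
      refine Polynomial.funext fun t => ?_
      have := hb i t
      simp only [h0, eval_zero, sign_zero] at this
      simpa using (sign_eq_zero_iff.1 this)
  set P : ℝ → ℝ := fun s => p.eval (h.symm s) with hP
  have hPc : Continuous P := p.continuous.comp h.symm.continuous
  have hev1 := (h.symm.tendsto_atBot.eventually (eventually_atBot_sign_eval hp)).and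
    (eventually_atBot_sign_eval hq)
  have hev2 := (h.symm.tendsto_atTop.eventually (eventually_atTop_sign_eval hp)).and
    (eventually_atTop_sign_eval hq)
  obtain ⟨m, hm⟩ := eventually_atBot.1 hev1
  obtain ⟨M, hM⟩ := eventually_atTop.1 hev2
  set Z₀ : Finset ℝ := Finset.univ.biUnion fun i => (b' i).roots.toFinset with hZ₀
  have memZ₀ : ∀ z, z ∈ Z₀ ↔ ∃ i, b' i ≠ 0 ∧ (b' i).eval z = 0 := by
    intro z
    simp [hZ₀, mem_roots', IsRoot]
  have hsymm : ∀ i z, SignType.sign ((b i).eval (h.symm z)) = SignType.sign ((b' i).eval z) := by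
    intro i z
    rw [hb, OrderIso.apply_symm_apply]
  set Z : Finset ℝ := insert m (insert M Z₀) with hZ
  have hder0 : b' j ≠ 0 := by
    rw [hj']
    intro h0
    have := Polynomial.derivative_eq_zero.1 h0
    omega
  have hlow : ∀ s ≤ m, ∀ s' ≤ m, P s ≠ 0 ∧ SignType.sign (P s) = SignType.sign (q.eval s') := by
    intro s hs s' hs'
    have h1 := (hm s hs).1
    have h2 := (hm s' hs').2
    refine ⟨?_, ?_⟩
    · rw [← sign_ne_zero, hP, h1]
      exact mul_ne_zero hlc0 (by simp [sign_eq_zero_iff])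
    · rw [hP, h1, h2, hlc, hdeg]
  have hhigh : ∀ s, M ≤ s → ∀ s', M ≤ s' →
      P s ≠ 0 ∧ SignType.sign (P s) = SignType.sign (q.eval s') := by
    intro s hs s' hs'
    have h1 := (hM s hs).1
    have h2 := (hM s' hs').2
    refine ⟨?_, ?_⟩
    · rw [← sign_ne_zero, hP, h1]
      exact hlc0
    · rw [hP, h1, h2, hlc]
  obtain ⟨k, hkZ, hk⟩ := exists_orderIso_sign_eq (P := P) (q := fun t => q.eval t) hPc
    q.continuous Z
    (by
      intro a _ c _ hac
      have : InjOn (fun t => p.eval t) (Icc (h.symm a) (h.symm c)) := by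
        refine injOn_Icc_of_derivative_ne_zero fun t ht h0 => ?_
        have h1 : h t ∈ Z₀ := by
          refine (memZ₀ _).2 ⟨j, hder0, ?_⟩
          rw [← sign_eq_zero_iff, ← hb j, hj, h0, sign_zero]
        refine hac (h t) (by simp [hZ, h1]) ⟨?_, ?_⟩
        · simpa using h.lt_iff_lt.2 ht.1
        · simpa using h.lt_iff_lt.2 ht.2
      intro s hs t ht hst
      refine h.symm.injective (this ⟨?_, ?_⟩ ⟨?_, ?_⟩ hst)
      · exact h.symm.le_iff_le.2 hs.1
      · exact h.symm.le_iff_le.2 hs.2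
      · exact h.symm.le_iff_le.2 ht.1
      · exact h.symm.le_iff_le.2 ht.2)
    (by
      intro a _ c _ hac
      refine injOn_Icc_of_derivative_ne_zero fun t ht h0 => ?_
      refine hac t ?_ ht
      have : t ∈ Z₀ := (memZ₀ _).2 ⟨j, hder0, by rw [hj', h0]⟩
      simp [hZ, this])
    (by
      intro z hz
      rcases Finset.mem_insert.1 hz with rfl | hz
      · exact (hlow z le_rfl z le_rfl).2
      rcases Finset.mem_insert.1 hz with rfl | hz
      · exact (hhigh z le_rfl z le_rfl).2
      obtain ⟨i, hi, hi0⟩ := (memZ₀ z).1 hz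
      have := hroots i (h.symm z) (by rwa [Ne, hbne i])
        (by rw [← sign_eq_zero_iff, hsymm, hi0, sign_zero])
      simpa [hP] using this)
    (fun s s' hs hs' => hlow s (hs m (by simp [hZ])).le s' (hs' m (by simp [hZ])).le)
    (fun s s' hs hs' => hhigh s (hs M (by simp [hZ])).le s' (hs' M (by simp [hZ])).le)
    (by
      have : {s | P s = 0} ⊆ h '' {t | t ∈ p.roots.toFinset} := by
        intro s hs
        refine ⟨h.symm s, ?_, by simp⟩
        simpa [hp0] using hs
      exact (((p.roots.toFinset).finite_toSet).image h).subset this)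
  refine ⟨h.trans k, fun i t => ?_, fun t => ?_⟩
  · rw [hb, OrderIso.trans_apply]
    by_cases hi : b' i = 0
    · simp [hi]
    refine (sign_comp_orderIso_of_fixes_roots (b' i).continuous k (fun z hz => ?_) _).symm
    have : z ∈ Z₀ := (memZ₀ z).2 ⟨i, hi, hz⟩
    exact hkZ z (by simp [hZ, this])
  · simpa [hP] using hk (h t)

/-- Thom's lemma: if all iterated derivatives of `f` have equal signs at `u` and at `v`, then `f`
keeps its sign between `u` and `v`. -/
theorem Polynomial.sign_eval_eq_of_mem_Icc {f : ℝ[X]} {u v w : ℝ} (hw : w ∈ Icc u v)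
    (h : ∀ k, SignType.sign ((derivative^[k] f).eval u) =
      SignType.sign ((derivative^[k] f).eval v)) :
    SignType.sign (f.eval w) = SignType.sign (f.eval u) := by
  induction hn : f.natDegree using Nat.strong_induction_on generalizing f w with
  | _ n ih =>
    subst hn
    rcases Nat.eq_zero_or_pos f.natDegree with h0 | h0
    · rw [eq_C_of_natDegree_eq_zero h0, eval_C, eval_C]
    have hd : ∀ w ∈ Icc u v, SignType.sign (f.derivative.eval w) =
        SignType.sign (f.derivative.eval u) := fun w hw =>
      ih _ (natDegree_derivative_lt h0.ne') hw (fun k => by simpa using h (k + 1)) rfl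
    have huv : SignType.sign (f.eval u) = SignType.sign (f.eval v) := h 0
    have hmono : MonotoneOn (fun t => f.eval t) (Icc u v) ∨
        AntitoneOn (fun t => f.eval t) (Icc u v) := by
      rcases le_total 0 (f.derivative.eval u) with hs | hs
      · left
        refine monotoneOn_of_deriv_nonneg (convex_Icc u v) f.continuous.continuousOn
          f.differentiable.differentiableOn fun t ht => ?_
        rw [interior_Icc] at ht
        have := hd t (Ioo_subset_Icc_self ht)
        rw [Polynomial.deriv]
        rw [← sign_nonneg_iff] at hs ⊢
        rwa [this]
      · right
        refine antitoneOn_of_deriv_nonpos (convex_Icc u v) f.continuous.continuousOn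
          f.differentiable.differentiableOn fun t ht => ?_
        rw [interior_Icc] at ht
        have := hd t (Ioo_subset_Icc_self ht)
        rw [Polynomial.deriv]
        rw [← sign_nonpos_iff] at hs ⊢
        rwa [this]
    have hu : u ∈ Icc u v := ⟨le_rfl, hw.1.trans hw.2⟩
    have hv : v ∈ Icc u v := ⟨hw.1.trans hw.2, le_rfl⟩
    rcases hmono with hm | hm
    · refine le_antisymm ?_ (SignType.sign.monotone (hm hu hw hw.1))
      rw [huv]
      exact SignType.sign.monotone (hm hw hv hw.2)
    · refine le_antisymm (SignType.sign.monotone (hm hu hw hw.1)) ?_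
      rw [huv]
      exact SignType.sign.monotone (hm hw hv hw.2)

theorem Polynomial.natDegree_eq_of_coeff_eq_zero_iff {R S : Type*} [Semiring R] [Semiring S]
    {p : R[X]} {q : S[X]} (h : ∀ n, p.coeff n = 0 ↔ q.coeff n = 0) :
    p.natDegree = q.natDegree := by
  have : p.support = q.support := by
    ext n
    simp [mem_support_iff, h n]
  rw [natDegree, natDegree, degree, degree, this]

end Univariate

section Parametric

open Polynomial

theorem Polynomial.exists_pseudo_remainder {A : Type*} [CommRing A] (f g : A[X])
    (hg : 0 < g.natDegree) :
    ∃ (k : ℕ) (q r : A[X]), r.natDegree < g.natDegree ∧ C g.leadingCoeff ^ k * f = q * g + r := by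
  induction hn : f.natDegree using Nat.strong_induction_on generalizing f with
  | _ n ih =>
    subst hn
    rcases lt_or_ge f.natDegree g.natDegree with h | h
    · exact ⟨0, 0, f, h, by simp⟩
    set f' := C g.leadingCoeff * f - C f.leadingCoeff * (g * X ^ (f.natDegree - g.natDegree))
      with hf'
    have h1 : f'.natDegree ≤ f.natDegree := by
      refine (natDegree_sub_le _ _).trans (max_le (natDegree_C_mul_le _ _) ?_)
      refine (natDegree_C_mul_le _ _).trans (natDegree_mul_le.trans ?_)
      have := natDegree_X_pow_le (R := A) (f.natDegree - g.natDegree)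
      omega
    have h2 : f'.coeff f.natDegree = 0 := by
      rw [hf', coeff_sub, coeff_C_mul, coeff_C_mul, coeff_mul_X_pow', if_pos (by omega),
        show f.natDegree - (f.natDegree - g.natDegree) = g.natDegree by omega]
      simp only [leadingCoeff]
      ring
    have h3 : f'.natDegree < f.natDegree := by
      refine lt_of_le_of_ne h1 fun h => ?_
      rw [← h, ← leadingCoeff, leadingCoeff_eq_zero] at h2
      rw [h2, natDegree_zero] at h
      omega
    obtain ⟨k, q, r, hr, he⟩ := ih _ h3 f' rfl
    refine ⟨k + 1, q + C g.leadingCoeff ^ k * C f.leadingCoeff * X ^ (f.natDegree - g.natDegree),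
      r, hr, ?_⟩
    rw [hf'] at he
    linear_combination he

/-- A choice of pseudo-remainders, with even powers of the leading coefficient. -/
theorem Polynomial.exists_pseudo_remainder_fun (A : Type*) [CommRing A] :
    ∃ rem : A[X] → A[X] → A[X], ∀ f g, (rem f g).natDegree < max 1 g.natDegree ∧
      (0 < g.natDegree → ∃ (k : ℕ) (q : A[X]),
        C (g.leadingCoeff ^ (2 * k)) * f = q * g + rem f g) := by
  have : ∀ f g : A[X], ∃ r : A[X], r.natDegree < max 1 g.natDegree ∧
      (0 < g.natDegree → ∃ (k : ℕ) (q : A[X]),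
        C (g.leadingCoeff ^ (2 * k)) * f = q * g + r) := by
    intro f g
    rcases Nat.eq_zero_or_pos g.natDegree with hg | hg
    · exact ⟨0, by simp, fun h => by omega⟩
    · obtain ⟨k, q, r, hr, he⟩ := exists_pseudo_remainder f g hg
      refine ⟨C (g.leadingCoeff ^ k) * r,
        ((natDegree_C_mul_le _ _).trans_lt hr).trans_le (le_max_right _ _),
        fun _ => ⟨k, C (g.leadingCoeff ^ k) * q, ?_⟩⟩
      simp only [map_pow]
      linear_combination C g.leadingCoeff ^ k * he
  choose rem h using this
  exact ⟨rem, h⟩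

/-- The part of degree at most `e` of a polynomial. -/
noncomputable def Polynomial.lowPart {A : Type*} [Semiring A] (e : ℕ) (g : A[X]) : A[X] :=
  ∑ i ∈ Finset.range (e + 1), monomial i (g.coeff i)

theorem Polynomial.coeff_lowPart {A : Type*} [Semiring A] (e : ℕ) (g : A[X]) (n : ℕ) :
    (lowPart e g).coeff n = if n ≤ e then g.coeff n else 0 := by
  simp [lowPart, coeff_monomial]

theorem Polynomial.natDegree_lowPart_le {A : Type*} [Semiring A] (e : ℕ) (g : A[X]) :
    (lowPart e g).natDegree ≤ e := by
  rw [natDegree_le_iff_coeff_eq_zero]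
  intro n hn
  rw [coeff_lowPart, if_neg (by omega)]

theorem Polynomial.map_lowPart {A B : Type*} [Semiring A] [Semiring B] (φ : A →+* B) (g : A[X])
    {e : ℕ} (he : (g.map φ).natDegree ≤ e) : (lowPart e g).map φ = g.map φ := by
  ext n
  rw [coeff_map, coeff_lowPart]
  split_ifs with h
  · rw [coeff_map]
  · rw [map_zero, coeff_eq_zero_of_natDegree_lt (by omega)]

variable {σ : Type*}

/-- The polynomials in `G` take the same signs at `x` and `y`. -/
def SameSigns (G : Finset (MvPolynomial σ ℝ)) (x y : σ → ℝ) : Prop :=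
  ∀ g ∈ G, SignType.sign (MvPolynomial.eval x g) = SignType.sign (MvPolynomial.eval y g)

theorem SameSigns.mono {G G' : Finset (MvPolynomial σ ℝ)} {x y : σ → ℝ} (h : SameSigns G' x y)
    (hG : G ⊆ G') : SameSigns G x y := fun g hg => h g (hG hg)

/-- Finitely many sign conditions on the parameter determine, up to an increasing bijection of the
line, all signs of the polynomials in the family `F`. -/
def IsMatched (F : Finset (MvPolynomial σ ℝ)[X]) : Prop :=
  ∃ G : Finset (MvPolynomial σ ℝ), ∀ x y, SameSigns G x y → ∃ h : ℝ ≃o ℝ, ∀ f ∈ F, ∀ t,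
    SignType.sign ((f.map (MvPolynomial.eval x)).eval t) =
      SignType.sign ((f.map (MvPolynomial.eval y)).eval (h t))

theorem IsMatched.mono {F F' : Finset (MvPolynomial σ ℝ)[X]} (h : IsMatched F') (hF : F ⊆ F') :
    IsMatched F := by
  obtain ⟨G, hG⟩ := h
  refine ⟨G, fun x y hxy => ?_⟩
  obtain ⟨k, hk⟩ := hG x y hxy
  exact ⟨k, fun f hf => hk f (hF hf)⟩

open Classical in
/-- The finite set of coefficients of a polynomial. -/
noncomputable def coeffFinset (f : (MvPolynomial σ ℝ)[X]) : Finset (MvPolynomial σ ℝ) :=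
  (Finset.range (f.natDegree + 1)).image f.coeff

theorem SameSigns.coeff {f : (MvPolynomial σ ℝ)[X]} {x y : σ → ℝ}
    (h : SameSigns (coeffFinset f) x y) (n : ℕ) :
    SignType.sign ((f.map (MvPolynomial.eval x)).coeff n) =
      SignType.sign ((f.map (MvPolynomial.eval y)).coeff n) := by
  classical
  rw [coeff_map, coeff_map]
  rcases lt_or_ge n (f.natDegree + 1) with hn | hn
  · exact h _ (Finset.mem_image_of_mem _ (Finset.mem_range.2 hn))
  · simp [coeff_eq_zero_of_natDegree_lt hn]

theorem SameSigns.natDegree_eq {f : (MvPolynomial σ ℝ)[X]} {x y : σ → ℝ}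
    (h : SameSigns (coeffFinset f) x y) :
    (f.map (MvPolynomial.eval x)).natDegree = (f.map (MvPolynomial.eval y)).natDegree :=
  natDegree_eq_of_coeff_eq_zero_iff fun n => by
    rw [← sign_eq_zero_iff, h.coeff n, sign_eq_zero_iff]

/-- At a root of a specialisation of `g`, the sign of `f` is that of the pseudo-remainder. -/
theorem sign_eval_eq_sign_eval_pseudo_remainder
    {rem : (MvPolynomial σ ℝ)[X] → (MvPolynomial σ ℝ)[X] → (MvPolynomial σ ℝ)[X]}
    (hrem : ∀ f g, 0 < g.natDegree → ∃ (k : ℕ) (q : (MvPolynomial σ ℝ)[X]),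
        C (g.leadingCoeff ^ (2 * k)) * f = q * g + rem f g)
    (f : (MvPolynomial σ ℝ)[X]) {g : (MvPolynomial σ ℝ)[X]} {x : σ → ℝ} {e : ℕ}
    (he : (g.map (MvPolynomial.eval x)).natDegree = e) (h0 : g.map (MvPolynomial.eval x) ≠ 0)
    {t : ℝ} (ht : (g.map (MvPolynomial.eval x)).eval t = 0) :
    SignType.sign ((f.map (MvPolynomial.eval x)).eval t) =
      SignType.sign (((rem f (lowPart e g)).map (MvPolynomial.eval x)).eval t) := by
  have hepos : 0 < e := by
    rcases Nat.eq_zero_or_pos e with h | h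
    · rw [h] at he
      rw [eq_C_of_natDegree_eq_zero he, eval_C] at ht
      exact absurd (by rw [eq_C_of_natDegree_eq_zero he, ht, C_0]) h0
    · exact h
  have hlc : MvPolynomial.eval x (g.coeff e) ≠ 0 := by
    rw [← coeff_map, ← he, ← leadingCoeff]
    exact leadingCoeff_ne_zero.2 h0
  have hd : (lowPart e g).natDegree = e := by
    refine le_antisymm (natDegree_lowPart_le e g) (le_natDegree_of_ne_zero ?_)
    rw [coeff_lowPart, if_pos le_rfl]
    rintro h
    simp [h] at hlc
  obtain ⟨k, q, hk⟩ := hrem f (lowPart e g) (by rwa [hd])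
  have := congrArg (fun p => (p.map (MvPolynomial.eval x)).eval t) hk
  simp only [Polynomial.map_mul, Polynomial.map_add, eval_mul, eval_add, map_lowPart _ _ he.le, ht,
    mul_zero, zero_add, map_C, eval_C, leadingCoeff, hd, coeff_lowPart, le_refl, if_true] at this
  rw [← this, sign_mul, sign_pos (a := MvPolynomial.eval x (g.coeff e ^ (2 * k)))
    (by rw [map_pow, pow_mul]; positivity), one_mul]

open Classical in
theorem IsMatched.insert
    {rem : (MvPolynomial σ ℝ)[X] → (MvPolynomial σ ℝ)[X] → (MvPolynomial σ ℝ)[X]}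
    (hrem : ∀ f g, 0 < g.natDegree → ∃ (k : ℕ) (q : (MvPolynomial σ ℝ)[X]),
        C (g.leadingCoeff ^ (2 * k)) * f = q * g + rem f g)
    {B : Finset (MvPolynomial σ ℝ)[X]} {f : (MvPolynomial σ ℝ)[X]} (hf : derivative f ∈ B)
    (hM : IsMatched (B ∪ B.biUnion fun g =>
      (Finset.range (g.natDegree + 1)).image fun e => rem f (lowPart e g))) :
    IsMatched (insert f B) := by
  obtain ⟨G, hG⟩ := hM
  refine ⟨G ∪ (coeffFinset f ∪ B.biUnion coeffFinset), fun x y hxy => ?_⟩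
  obtain ⟨h, hh⟩ := hG x y (hxy.mono Finset.subset_union_left)
  have hcf : SameSigns (coeffFinset f) x y :=
    hxy.mono (Finset.subset_union_left.trans Finset.subset_union_right)
  have hcB : ∀ g ∈ B, SameSigns (coeffFinset g) x y := fun g hg =>
    hxy.mono (((Finset.subset_biUnion_of_mem coeffFinset hg).trans
      Finset.subset_union_right).trans Finset.subset_union_right)
  have hfd := hcf.natDegree_eq
  have hroots : ∀ (i : B) t, i.1.map (MvPolynomial.eval x) ≠ 0 →
      (i.1.map (MvPolynomial.eval x)).eval t = 0 →
      SignType.sign ((f.map (MvPolynomial.eval x)).eval t) =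
        SignType.sign ((f.map (MvPolynomial.eval y)).eval (h t)) := by
    rintro ⟨g, hg⟩ t hg0 hgt
    simp only at hg0 hgt
    have hgd := (hcB g hg).natDegree_eq
    have hlc := (hcB g hg).coeff (g.map (MvPolynomial.eval x)).natDegree
    have hg0' : g.map (MvPolynomial.eval y) ≠ 0 := by
      rw [← leadingCoeff_ne_zero, leadingCoeff, ← hgd, ← sign_ne_zero, ← hlc, sign_ne_zero]
      exact leadingCoeff_ne_zero.2 hg0
    have hgt' : (g.map (MvPolynomial.eval y)).eval (h t) = 0 := by
      rw [← sign_eq_zero_iff, ← hh g (Finset.mem_union_left _ hg) t, hgt, sign_zero]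
    rw [sign_eval_eq_sign_eval_pseudo_remainder hrem f rfl hg0 hgt,
      sign_eval_eq_sign_eval_pseudo_remainder hrem f hgd.symm hg0' hgt']
    refine hh _ (Finset.mem_union_right _ (Finset.mem_biUnion.2 ⟨g, hg, ?_⟩)) t
    exact Finset.mem_image.2 ⟨_, Finset.mem_range.2 (Nat.lt_succ_of_le (natDegree_map_le)), rfl⟩
  have hlc : SignType.sign (f.map (MvPolynomial.eval x)).leadingCoeff =
      SignType.sign (f.map (MvPolynomial.eval y)).leadingCoeff := by
    rw [leadingCoeff, leadingCoeff, ← hfd]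
    exact hcf.coeff _
  obtain ⟨h', h1, h2⟩ := Polynomial.exists_orderIso_sign_eval_insert
    (ι := B) (b := fun i => i.1.map (MvPolynomial.eval x))
    (b' := fun i => i.1.map (MvPolynomial.eval y)) (h := h) (j := ⟨_, hf⟩)
    (fun i t => hh i.1 (Finset.mem_union_left _ i.2) t)
    (derivative_map _ _).symm (derivative_map _ _).symm hroots hfd hlc
  refine ⟨h', fun g hg t => ?_⟩
  rcases Finset.mem_insert.1 hg with rfl | hg
  · exact h2 t
  · exact h1 ⟨g, hg⟩ t

theorem isMatched (F : Finset (MvPolynomial σ ℝ)[X]) : IsMatched F := by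
  classical
  obtain ⟨rem, hrem⟩ := exists_pseudo_remainder_fun (MvPolynomial σ ℝ)
  suffices H : ∀ d, ∀ F : Finset (MvPolynomial σ ℝ)[X], (∀ f ∈ F, f.natDegree ≤ d) →
      IsMatched F from H (F.sup natDegree) F fun f hf => Finset.le_sup (f := natDegree) hf
  intro d
  induction d with
  | zero =>
    intro F hF
    refine ⟨F.biUnion coeffFinset, fun x y hxy => ⟨OrderIso.refl ℝ, fun f hf t => ?_⟩⟩
    have h0 : f.natDegree = 0 := Nat.le_zero.1 (hF f hf)
    have := (hxy.mono (Finset.subset_biUnion_of_mem coeffFinset hf)).coeff 0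
    rw [eq_C_of_natDegree_eq_zero h0]
    simpa [coeff_map] using this
  | succ d ih =>
    have key : ∀ D : Finset (MvPolynomial σ ℝ)[X], (∀ f ∈ D, f.natDegree ≤ d + 1) →
        ∀ B : Finset (MvPolynomial σ ℝ)[X], (∀ f ∈ B, f.natDegree ≤ d) → IsMatched (B ∪ D) := by
      intro D
      induction D using Finset.induction_on with
      | empty => intro _ B hB; simpa using ih B hB
      | insert f D _ ihD =>
        intro hD B hB
        have hf := hD f (Finset.mem_insert_self _ _)
        have hD' : ∀ g ∈ D, g.natDegree ≤ d + 1 := fun g hg => hD g (Finset.mem_insert_of_mem hg)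
        set E := insert (derivative f) B ∪ D with hE
        set R := E.biUnion fun g =>
          (Finset.range (g.natDegree + 1)).image fun e => rem f (lowPart e g) with hR
        have hEd : ∀ g ∈ insert (derivative f) B, g.natDegree ≤ d := by
          intro g hg
          rcases Finset.mem_insert.1 hg with rfl | hg
          · exact (natDegree_derivative_le f).trans (by omega)
          · exact hB g hg
        have hE1 : ∀ g ∈ E, g.natDegree ≤ d + 1 := by
          intro g hg
          rcases Finset.mem_union.1 hg with hg | hg
          · exact (hEd g hg).trans (by omega)
          · exact hD' g hg
        have hRd : ∀ g ∈ R, g.natDegree ≤ d := by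
          intro r hr
          obtain ⟨g, hg, hr⟩ := Finset.mem_biUnion.1 hr
          obtain ⟨e, he, rfl⟩ := Finset.mem_image.1 hr
          have h1 := (hrem f (lowPart e g)).1
          have h2 := natDegree_lowPart_le e g
          have h3 := hE1 g hg
          have h4 := Finset.mem_range.1 he
          omega
        have hM : IsMatched (E ∪ R) := by
          refine (ihD hD' (insert (derivative f) B ∪ R) fun g hg => ?_).mono ?_
          · rcases Finset.mem_union.1 hg with hg | hg
            · exact hEd g hg
            · exact hRd g hg
          · rw [hE, Finset.union_right_comm]
        refine (IsMatched.insert (fun f g => (hrem f g).2) (f := f) (B := E)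
          (by simp [hE]) hM).mono ?_
        intro g hg
        simp only [hE, Finset.mem_union, Finset.mem_insert] at hg ⊢
        tauto
    intro F hF
    simpa using key F hF ∅ (by simp)

end Parametric

section SignDetermined

variable {σ τ : Type*}

/-- A set is sign-determined if it is a union of cells given by the signs of finitely many
polynomials. In finitely many variables these are the semialgebraic sets. -/
def IsSignDetermined (S : Set (σ → ℝ)) : Prop :=
  ∃ F : Finset (MvPolynomial σ ℝ), ∀ x y, SameSigns F x y → x ∈ S → y ∈ S

theorem IsSemialgebraic.isSignDetermined {n : ℕ} {S : Set (Fin n → ℝ)} (h : IsSemialgebraic S) :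
    IsSignDetermined S := by
  classical
  obtain ⟨L, rfl⟩ := h
  refine ⟨(L.flatten.flatMap fun b => b.1 :: b.2).toFinset, fun x y hxy hx => ?_⟩
  simp only [mem_iUnion, mem_iInter, BasicSemialgebraic, mem_ofPred_eq] at hx ⊢
  obtain ⟨c, hc, hx⟩ := hx
  have key : ∀ b ∈ c, ∀ g ∈ b.1 :: b.2, SignType.sign (MvPolynomial.eval x g) =
      SignType.sign (MvPolynomial.eval y g) := by
    intro b hb g hg
    refine hxy g ?_
    rw [List.mem_toFinset, List.mem_flatMap]
    exact ⟨b, List.mem_flatten.2 ⟨c, hc, hb⟩, hg⟩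
  refine ⟨c, hc, fun b hb => ⟨?_, fun g hg => ?_⟩⟩
  · rw [← sign_eq_zero_iff, ← key b hb b.1 (by simp), (hx b hb).1, sign_zero]
  · rw [← sign_eq_one_iff, ← key b hb g (by simp [hg]), sign_pos ((hx b hb).2 g hg)]

theorem IsSignDetermined.isSemialgebraic {n : ℕ} {S : Set (Fin n → ℝ)} (h : IsSignDetermined S) :
    IsSemialgebraic S := by
  classical
  obtain ⟨F, hF⟩ := h
  let basic : SignType → MvPolynomial (Fin n) ℝ →
      MvPolynomial (Fin n) ℝ × List (MvPolynomial (Fin n) ℝ) := fun s f =>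
    if s = 0 then (f, []) else if s = 1 then (0, [f]) else (0, [-f])
  have hbasic : ∀ s f x, x ∈ BasicSemialgebraic (basic s f).1 (basic s f).2 ↔
      SignType.sign (MvPolynomial.eval x f) = s := by
    intro s f x
    rcases SignType.trichotomy s with rfl | rfl | rfl
    · simp [basic, BasicSemialgebraic, sign_eq_neg_one_iff]
    · simp [basic, BasicSemialgebraic]
    · simp [basic, BasicSemialgebraic, sign_eq_one_iff]
  refine ⟨((Finset.univ : Finset (F → SignType)).filter fun s =>
    ∃ x ∈ S, ∀ f : F, SignType.sign (MvPolynomial.eval x f.1) = s f).toList.map fun s =>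
      (Finset.univ : Finset F).toList.map fun f => basic (s f) f.1, ?_⟩
  ext x
  simp only [mem_iUnion, mem_iInter, List.mem_map, Finset.mem_toList, Finset.mem_filter,
    Finset.mem_univ, true_and, exists_prop]
  constructor
  · intro hx
    refine ⟨_, ⟨fun f => SignType.sign (MvPolynomial.eval x f.1), ⟨x, hx, fun f => rfl⟩, rfl⟩, ?_⟩
    rintro b hb
    obtain ⟨f, _, rfl⟩ := List.mem_map.1 hb
    exact (hbasic _ _ _).2 rfl
  · rintro ⟨_, ⟨s, ⟨y, hy, hys⟩, rfl⟩, hx⟩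
    refine hF y x (fun f hf => ?_) hy
    rw [hys ⟨f, hf⟩]
    exact ((hbasic _ _ _).1 (hx _ (List.mem_map.2 ⟨⟨f, hf⟩, by simp, rfl⟩))).symm

theorem IsSignDetermined.inter {S T : Set (σ → ℝ)} (hS : IsSignDetermined S)
    (hT : IsSignDetermined T) : IsSignDetermined (S ∩ T) := by
  classical
  obtain ⟨F, hF⟩ := hS
  obtain ⟨F', hF'⟩ := hT
  exact ⟨F ∪ F', fun x y hxy hx => ⟨hF x y (hxy.mono Finset.subset_union_left) hx.1,
    hF' x y (hxy.mono Finset.subset_union_right) hx.2⟩⟩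

theorem IsSignDetermined.preimage_comp {S : Set (σ → ℝ)} (hS : IsSignDetermined S) (e : σ → τ) :
    IsSignDetermined {x : τ → ℝ | x ∘ e ∈ S} := by
  classical
  obtain ⟨F, hF⟩ := hS
  refine ⟨F.image (MvPolynomial.rename e), fun x y hxy hx => hF _ _ (fun f hf => ?_) hx⟩
  have := hxy _ (Finset.mem_image_of_mem _ hf)
  rwa [MvPolynomial.eval_rename, MvPolynomial.eval_rename] at this

theorem isSignDetermined_eval_eq_zero (p : MvPolynomial σ ℝ) :
    IsSignDetermined {x | MvPolynomial.eval x p = 0} := by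
  refine ⟨{p}, fun x y hxy (hx : MvPolynomial.eval x p = 0) => ?_⟩
  have := hxy p (Finset.mem_singleton_self p)
  rw [hx, sign_zero] at this
  exact sign_eq_zero_iff.1 this.symm

theorem isSignDetermined_iInter {ι : Type*} [Finite ι] {S : ι → Set (σ → ℝ)}
    (h : ∀ i, IsSignDetermined (S i)) : IsSignDetermined (⋂ i, S i) := by
  classical
  cases nonempty_fintype ι
  choose F hF using h
  refine ⟨Finset.univ.biUnion F, fun x y hxy hx => mem_iInter.2 fun i => hF i x y (hxy.mono ?_)
    (mem_iInter.1 hx i)⟩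
  exact Finset.subset_biUnion_of_mem F (Finset.mem_univ i)

theorem isSignDetermined_coord_eq_const (i : σ) (c : ℝ) :
    IsSignDetermined {x : σ → ℝ | x i = c} := by
  convert isSignDetermined_eval_eq_zero (MvPolynomial.X i - MvPolynomial.C c) using 1
  ext x
  simp [sub_eq_zero]

theorem isSignDetermined_comp_eq_const {ι : Type*} [Finite ι] (a : ι → σ) (c : ι → ℝ) :
    IsSignDetermined {x : σ → ℝ | x ∘ a = c} := by
  have := isSignDetermined_iInter fun i => isSignDetermined_coord_eq_const (a i) (c i)
  convert this using 1
  ext x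
  simp [funext_iff]

/-- Tarski–Seidenberg for one variable. -/
theorem IsSignDetermined.exists_option {S : Set (Option σ → ℝ)} (hS : IsSignDetermined S) :
    IsSignDetermined {x : σ → ℝ | ∃ t, (fun o : Option σ => o.elim t x) ∈ S} := by
  classical
  obtain ⟨F, hF⟩ := hS
  obtain ⟨G, hG⟩ := isMatched (F.image (MvPolynomial.optionEquivLeft ℝ σ))
  refine ⟨G, fun x y hxy ⟨t, ht⟩ => ?_⟩
  obtain ⟨h, hh⟩ := hG x y hxy
  refine ⟨h t, hF _ _ (fun f hf => ?_) ht⟩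
  rw [MvPolynomial.optionEquivLeft_elim_eval, MvPolynomial.optionEquivLeft_elim_eval]
  exact hh _ (Finset.mem_image_of_mem _ hf) t

/-- Tarski–Seidenberg. -/
theorem IsSignDetermined.exists_sum {α : Type} [Finite α] {τ : Type} {S : Set (α ⊕ τ → ℝ)}
    (hS : IsSignDetermined S) :
    IsSignDetermined {y : τ → ℝ | ∃ x : α → ℝ, Sum.elim x y ∈ S} := by
  induction α using Finite.induction_empty_option with
  | of_equiv e ih =>
    have := ih (hS.preimage_comp (Sum.map e.symm id))
    convert this using 1
    ext y
    constructor
    · rintro ⟨x, hx⟩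
      refine ⟨x ∘ e, ?_⟩
      simpa [Sum.elim_comp_map, Function.comp_assoc] using hx
    · rintro ⟨x, hx⟩
      refine ⟨x ∘ e.symm, ?_⟩
      simpa [Sum.elim_comp_map] using hx
  | h_empty =>
    have := hS.preimage_comp (Sum.elim PEmpty.elim id : PEmpty ⊕ τ → τ)
    convert this using 1
    ext y
    have : ∀ x : PEmpty.{1} → ℝ, Sum.elim x y = y ∘ (Sum.elim PEmpty.elim id : PEmpty ⊕ τ → τ) := by
      intro x
      ext (i | i)
      · exact i.elim
      · rfl
    simp [this]
  | @h_option α _ ih =>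
    let e : Option α ⊕ τ → Option (α ⊕ τ) := Sum.elim (Option.map Sum.inl) (some ∘ Sum.inr)
    have := ih (hS.preimage_comp e).exists_option
    have key : ∀ (t : ℝ) (x : α → ℝ) (y : τ → ℝ),
        (fun o : Option (α ⊕ τ) => o.elim t (Sum.elim x y)) ∘ e =
          Sum.elim (fun o : Option α => o.elim t x) y := by
      intro t x y
      ext ((_ | i) | i) <;> rfl
    convert this using 1
    ext y
    simp only [mem_ofPred_eq, key]
    constructor
    · rintro ⟨x, hx⟩
      refine ⟨x ∘ some, x none, ?_⟩
      convert hx using 2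
      ext (_ | i) <;> rfl
    · rintro ⟨x, t, hx⟩
      exact ⟨_, hx⟩

/-- Images of sign-determined sets under maps with sign-determined graph. -/
theorem IsSignDetermined.image_of_graph {α : Type} [Finite α] {τ : Type} {S : Set (α → ℝ)}
    {f : (α → ℝ) → (τ → ℝ)}
    (hf : IsSignDetermined {z : α ⊕ τ → ℝ | z ∘ Sum.inl ∈ S ∧ z ∘ Sum.inr = f (z ∘ Sum.inl)}) :
    IsSignDetermined (f '' S) := by
  convert hf.exists_sum using 1
  ext y
  simp [eq_comm]

end SignDetermined

section Pieces

open Polynomial Filter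

/-- A subset of `X × Y` with preconnected nonempty fibres and open projection onto a preconnected
set is preconnected. -/
theorem IsPreconnected.of_fibers {X Y : Type*} [TopologicalSpace X] [TopologicalSpace Y] {D : Set X}
    (hD : IsPreconnected D) {B : Set (X × Y)} (hBD : ∀ p ∈ B, p.1 ∈ D)
    (hne : ∀ x ∈ D, ∃ t, (x, t) ∈ B) (hfib : ∀ x ∈ D, IsPreconnected {t | (x, t) ∈ B})
    (hopen : ∀ x t, (x, t) ∈ B → ∀ U ∈ 𝓝 t, ∀ᶠ x' in 𝓝[D] x, ∃ t' ∈ U, (x', t') ∈ B) :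
    IsPreconnected B := by
  let shadow : Set (X × Y) → Set X := fun W => {x | ∀ᶠ x' in 𝓝[D] x, ∃ t, (x', t) ∈ B ∩ W}
  have hshadow_open : ∀ W, ∃ O, IsOpen O ∧ ∀ x, x ∈ O ↔ x ∈ shadow W := by
    intro W
    refine ⟨{x | ∀ᶠ x' in 𝓝 x, x' ∈ D → ∃ t, (x', t) ∈ B ∩ W}, isOpen_setOfPred_eventually_nhds,
      fun x => ?_⟩
    exact eventually_nhdsWithin_iff.symm
  have hshadow : ∀ W, IsOpen W → ∀ x t, (x, t) ∈ B → (x, t) ∈ W → x ∈ shadow W := by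
    intro W hW x t hB ht
    obtain ⟨U, hU, V, hV, hUV⟩ := mem_nhds_prod_iff.1 (hW.mem_nhds ht)
    filter_upwards [hopen x t hB V hV, mem_nhdsWithin_of_mem_nhds hU] with x' hx' hx'U
    obtain ⟨t', ht', hB'⟩ := hx'
    exact ⟨t', hB', hUV ⟨hx'U, ht'⟩⟩
  have hmem : ∀ W x, x ∈ D → x ∈ shadow W → ∃ t, (x, t) ∈ B ∩ W := fun W x hx h =>
    Eventually.self_of_nhdsWithin (p := fun x => ∃ t, (x, t) ∈ B ∩ W) h hx
  rintro U V hU hV hcov ⟨⟨x1, t1⟩, hB1, hU1⟩ ⟨⟨x2, t2⟩, hB2, hV2⟩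
  obtain ⟨O1, hO1, hO1'⟩ := hshadow_open U
  obtain ⟨O2, hO2, hO2'⟩ := hshadow_open V
  obtain ⟨x, hx, hxU, hxV⟩ := hD O1 O2 hO1 hO2
    (fun x hx => by
      obtain ⟨t, ht⟩ := hne x hx
      rcases hcov ht with h | h
      · exact Or.inl ((hO1' x).2 (hshadow U hU x t ht h))
      · exact Or.inr ((hO2' x).2 (hshadow V hV x t ht h)))
    ⟨x1, hBD _ hB1, (hO1' x1).2 (hshadow U hU x1 t1 hB1 hU1)⟩
    ⟨x2, hBD _ hB2, (hO2' x2).2 (hshadow V hV x2 t2 hB2 hV2)⟩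
  obtain ⟨s1, h1, h1'⟩ := hmem U x hx ((hO1' x).1 hxU)
  obtain ⟨s2, h2, h2'⟩ := hmem V x hx ((hO2' x).1 hxV)
  have hc : Continuous fun t : Y => (x, t) := by fun_prop
  obtain ⟨t, ht, htU, htV⟩ := hfib x hx _ _ (hU.preimage hc) (hV.preimage hc)
    (fun t ht => hcov ht) ⟨s1, h1, h1'⟩ ⟨s2, h2, h2'⟩
  exact ⟨(x, t), ht, htU, htV⟩

variable {σ : Type*}

theorem continuous_eval_map_eval (f : (MvPolynomial σ ℝ)[X]) (u : ℝ) :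
    Continuous fun x : σ → ℝ => (f.map (MvPolynomial.eval x)).eval u := by
  have : (fun x : σ → ℝ => (f.map (MvPolynomial.eval x)).eval u) =
      fun x => MvPolynomial.eval x (f.eval (MvPolynomial.C u)) := by
    ext x
    rw [eval_map, ← eval₂_at_apply, MvPolynomial.eval_C]
  rw [this]
  exact MvPolynomial.continuous_eval _

theorem eventually_sign_eq {X : Type*} [TopologicalSpace X] {f : X → ℝ} {x : X}
    (hf : ContinuousAt f x) (h : f x ≠ 0) :
    ∀ᶠ y in 𝓝 x, SignType.sign (f y) = SignType.sign (f x) := by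
  have : ContinuousAt (fun y => SignType.sign (f y)) x :=
    (continuousAt_sign_of_ne_zero h).comp hf
  exact this.eventually (eventually_of_mem ((isOpen_discrete _).mem_nhds (mem_singleton _))
    fun _ h => h)

theorem isPreconnected_cell {F : Finset (MvPolynomial σ ℝ)[X]}
    (hF : ∀ f ∈ F, derivative f ∈ F) {D : Set (σ → ℝ)} (hD : IsPreconnected D)
    (hmatch : ∀ x ∈ D, ∀ y ∈ D, ∃ h : ℝ ≃o ℝ, ∀ f ∈ F, ∀ t,
      SignType.sign ((f.map (MvPolynomial.eval x)).eval t) =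
        SignType.sign ((f.map (MvPolynomial.eval y)).eval (h t)))
    (s : (MvPolynomial σ ℝ)[X] → SignType) :
    IsPreconnected {p : (σ → ℝ) × ℝ | p.1 ∈ D ∧
      ∀ f ∈ F, SignType.sign ((f.map (MvPolynomial.eval p.1)).eval p.2) = s f} := by
  have hiter : ∀ k, ∀ f ∈ F, derivative^[k] f ∈ F := by
    intro k
    induction k with
    | zero => exact fun f hf => hf
    | succ k ih => exact fun f hf => ih _ (hF f hf)
  have thom : ∀ (x : σ → ℝ) (u v w : ℝ), w ∈ Icc u v →
      (∀ f ∈ F, SignType.sign ((f.map (MvPolynomial.eval x)).eval u) =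
        SignType.sign ((f.map (MvPolynomial.eval x)).eval v)) →
      ∀ f ∈ F, SignType.sign ((f.map (MvPolynomial.eval x)).eval w) =
        SignType.sign ((f.map (MvPolynomial.eval x)).eval u) := by
    intro x u v w hw h f hf
    refine sign_eval_eq_of_mem_Icc hw fun k => ?_
    rw [iterate_derivative_map]
    exact h _ (hiter k f hf)
  set B := {p : (σ → ℝ) × ℝ | p.1 ∈ D ∧
      ∀ f ∈ F, SignType.sign ((f.map (MvPolynomial.eval p.1)).eval p.2) = s f} with hB
  have mem_B : ∀ x t, (x, t) ∈ B ↔ x ∈ D ∧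
      ∀ f ∈ F, SignType.sign ((f.map (MvPolynomial.eval x)).eval t) = s f := fun x t => Iff.rfl
  rcases B.eq_empty_or_nonempty with h0 | ⟨⟨x0, t0⟩, h0⟩
  · rw [h0]
    exact isPreconnected_empty
  refine hD.of_fibers (fun p hp => hp.1) (fun x hx => ?_) (fun x hx => ?_) ?_
  · obtain ⟨h, hh⟩ := hmatch x0 h0.1 x hx
    exact ⟨h t0, hx, fun f hf => (hh f hf t0).symm.trans (h0.2 f hf)⟩
  · refine OrdConnected.isPreconnected ⟨fun u hu v hv w hw => ⟨hx, fun f hf => ?_⟩⟩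
    rw [← hu.2 f hf]
    exact thom x u v w hw (fun f hf => (hu.2 f hf).trans (hv.2 f hf).symm) f hf
  · intro x1 t1 h1 U hU
    obtain ⟨a, b, ⟨ha, hb⟩, hab⟩ := mem_nhds_iff_exists_Ioo_subset.1 hU
    set Z : Set ℝ := {z | ∃ f ∈ F, f.map (MvPolynomial.eval x1) ≠ 0 ∧
      (f.map (MvPolynomial.eval x1)).eval z = 0} with hZ
    have hZfin : Z.Finite := by
      have : Z ⊆ ⋃ f ∈ F, {z | f.map (MvPolynomial.eval x1) ≠ 0 ∧
        (f.map (MvPolynomial.eval x1)).IsRoot z} := by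
        rintro z ⟨f, hf, h, h'⟩
        simp only [mem_iUnion]
        exact ⟨f, hf, h, h'⟩
      refine (F.finite_toSet.biUnion fun f _ => ?_).subset this
      by_cases h : f.map (MvPolynomial.eval x1) = 0
      · simp [h]
      · exact (finite_setOfPred_isRoot h).subset fun z hz => hz.2
    have hinf1 : ∃ u ∈ Ioo a t1, u ∉ Z := ((Ioo_infinite ha).sdiff hZfin).nonempty
    have hinf2 : ∃ v ∈ Ioo t1 b, v ∉ Z := ((Ioo_infinite hb).sdiff hZfin).nonempty
    obtain ⟨u, hu, huZ⟩ := hinf1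
    obtain ⟨v, hv, hvZ⟩ := hinf2
    have stable : ∀ u ∉ Z, ∀ᶠ x in 𝓝[D] x1, ∀ f ∈ F,
        SignType.sign ((f.map (MvPolynomial.eval x)).eval u) =
          SignType.sign ((f.map (MvPolynomial.eval x1)).eval u) := by
      intro u hu
      rw [F.eventually_all]
      intro f hf
      by_cases hf0 : f.map (MvPolynomial.eval x1) = 0
      · filter_upwards [self_mem_nhdsWithin] with x hx
        obtain ⟨h, hh⟩ := hmatch x1 h1.1 x hx
        have := hh f hf (h.symm u)
        rw [OrderIso.apply_symm_apply] at this
        rw [← this, hf0]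
        simp
      · refine mem_nhdsWithin_of_mem_nhds (eventually_sign_eq
          (continuous_eval_map_eval f u).continuousAt fun h => hu ⟨f, hf, hf0, h⟩)
    filter_upwards [stable u huZ, stable v hvZ, self_mem_nhdsWithin] with x hxu hxv hx
    obtain ⟨h, hh⟩ := hmatch x1 h1.1 x hx
    have hsymm : ∀ w, ∀ f ∈ F, SignType.sign ((f.map (MvPolynomial.eval x1)).eval (h.symm w)) =
        SignType.sign ((f.map (MvPolynomial.eval x)).eval w) := by
      intro w f hf
      rw [hh f hf, OrderIso.apply_symm_apply]
    rcases le_or_gt t1 (h.symm u) with hc1 | hc1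
    · refine ⟨u, hab ⟨hu.1, hu.2.trans hb⟩, hx, fun f hf => ?_⟩
      rw [hxu f hf, ← h1.2 f hf]
      exact (thom x1 u (h.symm u) t1 ⟨hu.2.le, hc1⟩
        (fun f hf => by rw [hsymm u f hf, hxu f hf]) f hf).symm
    rcases le_or_gt (h.symm v) t1 with hc2 | hc2
    · refine ⟨v, hab ⟨ha.trans hv.1, hv.2⟩, hx, fun f hf => ?_⟩
      rw [hxv f hf, ← h1.2 f hf]
      have hvv : ∀ f ∈ F, SignType.sign ((f.map (MvPolynomial.eval x1)).eval (h.symm v)) =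
          SignType.sign ((f.map (MvPolynomial.eval x1)).eval v) :=
        fun f hf => by rw [hsymm v f hf, hxv f hf]
      exact ((thom x1 (h.symm v) v t1 ⟨hc2, hv.1.le⟩ hvv f hf).trans (hvv f hf)).symm
    · refine ⟨h t1, hab ⟨?_, ?_⟩, hx, fun f hf => (hh f hf t1).symm.trans (h1.2 f hf)⟩
      · exact hu.1.trans (by simpa using h.lt_iff_lt.2 hc1)
      · exact lt_trans (by simpa using h.lt_iff_lt.2 hc2) hv.2

/-- Finitely many sign conditions cut the space into finitely many preconnected pieces. -/
theorem exists_finite_preconnected_cover {σ : Type} [Finite σ] (F : Finset (MvPolynomial σ ℝ)) :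
    ∃ 𝒞 : Set (Set (σ → ℝ)), 𝒞.Finite ∧ ⋃₀ 𝒞 = univ ∧
      ∀ P ∈ 𝒞, IsPreconnected P ∧ ∀ x ∈ P, ∀ y ∈ P, SameSigns F x y := by
  classical
  induction σ using Finite.induction_empty_option with
  | of_equiv e ih =>
    obtain ⟨𝒞, hfin, hcov, h⟩ := ih (F.image (MvPolynomial.rename e.symm))
    refine ⟨(fun P => (fun x => x ∘ e.symm) '' P) '' 𝒞, hfin.image _, ?_, ?_⟩
    · refine eq_univ_of_forall fun x => ?_
      obtain ⟨P, hP, hx⟩ := (hcov ▸ mem_univ (x ∘ e) : x ∘ e ∈ ⋃₀ 𝒞)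
      exact ⟨_, mem_image_of_mem _ hP, x ∘ e, hx, by ext; simp⟩
    · rintro _ ⟨P, hP, rfl⟩
      refine ⟨(h P hP).1.image _ (by fun_prop), ?_⟩
      rintro _ ⟨x, hx, rfl⟩ _ ⟨y, hy, rfl⟩ f hf
      have := (h P hP).2 x hx y hy _ (Finset.mem_image_of_mem _ hf)
      simpa [MvPolynomial.eval_rename] using this
  | h_empty =>
    refine ⟨{univ}, finite_singleton _, by simp, ?_⟩
    rintro P rfl
    exact ⟨subsingleton_univ.isPreconnected, fun x _ y _ f _ => by rw [Subsingleton.elim x y]⟩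
  | @h_option α _ ih =>
    set E : Finset (MvPolynomial α ℝ)[X] :=
      insert 0 ((F.image (MvPolynomial.optionEquivLeft ℝ α)).biUnion fun f =>
        (Finset.range (f.natDegree + 1)).image fun k => derivative^[k] f) with hE
    have hFE : ∀ f ∈ F, MvPolynomial.optionEquivLeft ℝ α f ∈ E := by
      intro f hf
      refine Finset.mem_insert_of_mem (Finset.mem_biUnion.2 ⟨_, Finset.mem_image_of_mem _ hf, ?_⟩)
      exact Finset.mem_image.2 ⟨0, by simp, rfl⟩
    have hder : ∀ f ∈ E, derivative f ∈ E := by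
      intro f hf
      rcases Finset.mem_insert.1 hf with rfl | hf
      · simp [hE]
      obtain ⟨g, hg, hf⟩ := Finset.mem_biUnion.1 hf
      obtain ⟨k, hk, rfl⟩ := Finset.mem_image.1 hf
      rw [← Function.iterate_succ_apply' derivative]
      rcases lt_or_ge g.natDegree (k + 1) with h | h
      · rw [iterate_derivative_eq_zero h]
        exact Finset.mem_insert_self _ _
      · exact Finset.mem_insert_of_mem (Finset.mem_biUnion.2 ⟨g, hg,
          Finset.mem_image.2 ⟨k + 1, Finset.mem_range.2 (by omega), rfl⟩⟩)
    obtain ⟨G, hG⟩ := isMatched E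
    obtain ⟨𝒞, hfin, hcov, h𝒞⟩ := ih G
    let ext : (E → SignType) → (MvPolynomial α ℝ)[X] → SignType := fun s f =>
      if hf : f ∈ E then s ⟨f, hf⟩ else 0
    let cell : Set (α → ℝ) × (E → SignType) → Set ((α → ℝ) × ℝ) := fun c =>
      {p | p.1 ∈ c.1 ∧ ∀ f ∈ E, SignType.sign ((f.map (MvPolynomial.eval p.1)).eval p.2) =
        ext c.2 f}
    let glue : (α → ℝ) × ℝ → (Option α → ℝ) := fun p o => o.elim p.2 p.1
    have hglue : Continuous glue := by
      refine continuous_pi fun o => ?_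
      cases o with
      | none => exact continuous_snd
      | some i => exact (continuous_apply i).comp continuous_fst
    refine ⟨(fun c => glue '' cell c) '' (𝒞 ×ˢ univ), (hfin.prod finite_univ).image _, ?_, ?_⟩
    · refine eq_univ_of_forall fun x => ?_
      obtain ⟨P, hP, hx⟩ := (hcov ▸ mem_univ (x ∘ some) : x ∘ some ∈ ⋃₀ 𝒞)
      let s : E → SignType := fun f =>
        SignType.sign ((f.1.map (MvPolynomial.eval (x ∘ some))).eval (x none))
      refine ⟨glue '' cell (P, s), ⟨(P, s), ⟨hP, trivial⟩, rfl⟩,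
        (x ∘ some, x none), ⟨hx, fun f hf => by simp [ext, s, hf]⟩, ?_⟩
      ext (_ | i) <;> rfl
    · rintro _ ⟨⟨P, s⟩, ⟨hP, -⟩, rfl⟩
      refine ⟨(isPreconnected_cell hder (h𝒞 P hP).1
        (fun x hx y hy => hG x y ((h𝒞 P hP).2 x hx y hy)) (ext s)).image _ hglue.continuousOn, ?_⟩
      rintro _ ⟨⟨x, t⟩, ⟨hx, hxs⟩, rfl⟩ _ ⟨⟨y, t'⟩, ⟨hy, hys⟩, rfl⟩ f hf
      rw [MvPolynomial.optionEquivLeft_elim_eval, MvPolynomial.optionEquivLeft_elim_eval]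
      exact (hxs _ (hFE f hf)).trans (hys _ (hFE f hf)).symm

end Pieces

section Topological

open Filter

theorem IsSignDetermined.exists_preconnected_cover {σ : Type} [Finite σ] {S : Set (σ → ℝ)}
    (hS : IsSignDetermined S) :
    ∃ 𝒞 : Set (Set (σ → ℝ)), 𝒞.Finite ∧ ⋃₀ 𝒞 = S ∧ ∀ P ∈ 𝒞, IsPreconnected P := by
  obtain ⟨F, hF⟩ := hS
  obtain ⟨𝒞, hfin, hcov, h⟩ := exists_finite_preconnected_cover F
  refine ⟨{P ∈ 𝒞 | P ⊆ S}, hfin.subset fun P hP => hP.1, ?_, fun P hP => (h P hP.1).1⟩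
  refine Subset.antisymm (sUnion_subset fun P hP => hP.2) fun x hx => ?_
  obtain ⟨P, hP, hxP⟩ := (hcov ▸ mem_univ x : x ∈ ⋃₀ 𝒞)
  exact ⟨P, ⟨hP, fun y hy => hF x y ((h P hP).2 x hxP y hy) hx⟩, hxP⟩

/-- A nonempty finite union of locally closed sets is locally closed at one of its points. -/
theorem exists_locally_closed_point {X ι : Type*} [TopologicalSpace X] [Finite ι] {L : ι → Set X}
    (hL : ∀ i, IsLocallyClosed (L i)) (hne : (⋃ i, L i).Nonempty) :
    ∃ x ∈ ⋃ i, L i, ∃ U, IsOpen U ∧ x ∈ U ∧ ∃ Z, IsClosed Z ∧ (⋃ i, L i) ∩ U = Z ∩ U := by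
  obtain ⟨U, ⟨hU, hUne⟩, hmin⟩ := exists_minimalFor_of_wellFoundedLT
    (fun U : Set X => IsOpen U ∧ ((⋃ i, L i) ∩ U).Nonempty)
    (fun U => {i | (L i ∩ U).Nonempty}) ⟨univ, isOpen_univ, by simpa using hne⟩
  obtain ⟨x, hxS, hxU⟩ := hUne
  obtain ⟨i, hxi⟩ := mem_iUnion.1 hxS
  obtain ⟨O, Z, hO, hZ, hOZ⟩ := hL i
  have hxO : x ∈ O := (hOZ ▸ hxi : x ∈ O ∩ Z).1
  refine ⟨x, hxS, O ∩ U, hO.inter hU, ⟨hxO, hxU⟩, Z, hZ, Subset.antisymm ?_ ?_⟩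
  · rintro y ⟨hyS, hyO, hyU⟩
    refine ⟨?_, hyO, hyU⟩
    by_contra hyZ
    have := hmin (j := U ∩ Zᶜ) ⟨hU.inter hZ.isOpen_compl, y, hyS, hyU, hyZ⟩
      (fun j hj => hj.mono (by gcongr; exact inter_subset_left))
    obtain ⟨z, hz, hzU, hzZ⟩ := this (show (L i ∩ U).Nonempty from ⟨x, hxi, hxU⟩)
    exact hzZ (hOZ ▸ hz : z ∈ O ∩ Z).2
  · rintro y ⟨hyZ, hyO, hyU⟩
    exact ⟨mem_iUnion.2 ⟨i, hOZ ▸ ⟨hyO, hyZ⟩⟩, hyO, hyU⟩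

theorem isLocallyClosed_cell {σ : Type*} (F : Finset (MvPolynomial σ ℝ)) (s : F → SignType) :
    IsLocallyClosed {x : σ → ℝ | ∀ f : F, SignType.sign (MvPolynomial.eval x f.1) = s f} := by
  refine ⟨⋂ f : F, {x | s f ≠ 0 → 0 < s f * MvPolynomial.eval x f.1},
    ⋂ f : F, {x | s f = 0 → MvPolynomial.eval x f.1 = 0},
    isOpen_iInter_of_finite fun f => ?_, isClosed_iInter fun f => ?_, ?_⟩
  · by_cases h : s f = 0
    · simp [h]
    · simpa [h] using isOpen_lt continuous_const
        (continuous_const.mul (MvPolynomial.continuous_eval f.1))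
  · by_cases h : s f = 0
    · simpa [h] using isClosed_eq (MvPolynomial.continuous_eval f.1) continuous_const
    · simp [h]
  · ext x
    simp only [mem_inter_iff, mem_iInter, mem_ofPred_eq, ← forall_and]
    refine forall_congr' fun f => ?_
    rcases SignType.trichotomy (s f) with h | h | h <;>
      simp [h, sign_eq_neg_one_iff, sign_eq_one_iff]

theorem IsSignDetermined.exists_locally_closed_point {σ : Type*} {S : Set (σ → ℝ)}
    (hS : IsSignDetermined S) (hne : S.Nonempty) :
    ∃ x ∈ S, ∃ U, IsOpen U ∧ x ∈ U ∧ ∃ Z, IsClosed Z ∧ S ∩ U = Z ∩ U := by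
  obtain ⟨F, hF⟩ := hS
  let ι := {s : F → SignType // ∃ x ∈ S, ∀ f : F, SignType.sign (MvPolynomial.eval x f.1) = s f}
  have key : S = ⋃ s : ι,
      {x : σ → ℝ | ∀ f : F, SignType.sign (MvPolynomial.eval x f.1) = s.1 f} := by
    ext x
    simp only [mem_iUnion, mem_ofPred_eq]
    constructor
    · intro hx
      exact ⟨⟨_, x, hx, fun f => rfl⟩, fun f => rfl⟩
    · rintro ⟨⟨s, y, hy, hys⟩, hx⟩
      exact hF y x (fun f hf => (hys ⟨f, hf⟩).trans (hx ⟨f, hf⟩).symm) hy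
  have := _root_.exists_locally_closed_point (fun s : ι => isLocallyClosed_cell F s.1)
    (key ▸ hne)
  rwa [← key] at this

end Topological

section ConstantRank

open Filter

variable {E F Y : Type*} [NormedAddCommGroup E] [NormedSpace ℝ E] [FiniteDimensional ℝ E]
  [NormedAddCommGroup F] [NormedSpace ℝ F] [FiniteDimensional ℝ F]
  [NormedAddCommGroup Y] [NormedSpace ℝ Y] [FiniteDimensional ℝ Y]

/-- If `L ∘ f` is an analytic submersion, it is locally a linear projection after an analytic
change of coordinates of the source. -/
theorem AnalyticAt.exists_straightening {g : E → Y} {x : E} (hg : AnalyticAt ℝ g x)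
    (hsurj : (fderiv ℝ g x).range = ⊤) :
    ∃ (K : Submodule ℝ E) (P : E →L[ℝ] K) (T : Y × K → E),
      AnalyticAt ℝ T (g x, P x) ∧ T (g x, P x) = x ∧ (∀ᶠ y in 𝓝 x, T (g y, P y) = y) ∧
        ∀ᶠ p in 𝓝 (g x, P x), g (T p) = p.1 := by
  have := FiniteDimensional.complete ℝ E
  have := FiniteDimensional.complete ℝ Y
  set g' := fderiv ℝ g x with hg'
  obtain ⟨P, hP⟩ := Submodule.ClosedComplemented.of_finiteDimensional g'.ker
  have hPr : P.range = ⊤ := LinearMap.range_eq_top.2 fun v => ⟨v, hP v⟩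
  have hcompl : IsCompl g'.ker P.ker := LinearMap.isCompl_of_proj hP
  let e := g'.equivProdOfSurjectiveOfIsCompl P hsurj hPr hcompl
  have hΦ : AnalyticAt ℝ (fun y => (g y, P y)) x := hg.prod (P.analyticAt x)
  have hder : HasStrictFDerivAt (fun y => (g y, P y)) (e : E →L[ℝ] Y × g'.ker) x := by
    exact hg.hasStrictFDerivAt.prodMk P.hasStrictFDerivAt
  let Φ := hder.toOpenPartialHomeomorph _
  have hcoe : (Φ : E → Y × g'.ker) = fun y => (g y, P y) := hder.toOpenPartialHomeomorph_coe
  have hx : x ∈ Φ.source := hder.mem_toOpenPartialHomeomorph_source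
  have hval : Φ x = (g x, P x) := by rw [hcoe]
  refine ⟨g'.ker, P, Φ.symm, ?_, ?_, ?_, ?_⟩
  · rw [← hval]
    exact Φ.analyticAt_symm' (i := e) hx (hcoe ▸ hΦ) (by rw [hcoe]; exact hder.hasFDerivAt.fderiv)
  · rw [← hval, Φ.left_inv hx]
  · filter_upwards [Φ.open_source.mem_nhds hx] with y hy
    have := Φ.left_inv hy
    rwa [hcoe] at this
  · rw [← hval]
    filter_upwards [Φ.open_target.mem_nhds (Φ.map_source hx)] with p hp
    have := congrArg Prod.fst (Φ.right_inv hp)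
    rwa [hcoe] at this

/-- The constant rank theorem, in the form of a factorisation through a linear projection. -/
theorem AnalyticAt.exists_factor_of_rank_le {f : E → F} {x : E} (hf : AnalyticAt ℝ f x)
    (L : F →L[ℝ] Y) (hL : (L ∘L fderiv ℝ f x).range = ⊤)
    (hrank : ∀ᶠ y in 𝓝 x, Module.finrank ℝ (fderiv ℝ f y).range ≤ Module.finrank ℝ Y) :
    ∃ H : Y → F, AnalyticAt ℝ H (L (f x)) ∧ ∀ᶠ y in 𝓝 x, f y = H (L (f y)) := by
  have hg : AnalyticAt ℝ (fun y => L (f y)) x := L.analyticAt _ |>.comp hf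
  have hg' : fderiv ℝ (fun y => L (f y)) x = L ∘L fderiv ℝ f x :=
    (L.hasFDerivAt.comp x hf.differentiableAt.hasFDerivAt).fderiv
  obtain ⟨K, P, T, hT, hTx, hTl, hTr⟩ := hg.exists_straightening (hg' ▸ hL)
  set p0 : Y × K := (L (f x), P x) with hp0
  have hTc : Tendsto T (𝓝 p0) (𝓝 x) := by
    have := hT.continuousAt.tendsto
    rwa [hTx] at this
  have hgood : ∀ᶠ p in 𝓝 p0, AnalyticAt ℝ (fun p => f (T p)) p ∧
      ∀ v : K, fderiv ℝ (fun p => f (T p)) p (0, v) = 0 := by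
    filter_upwards [hT.eventually_analyticAt, hTr.eventually_nhds,
      hTc.eventually hf.eventually_analyticAt, hTc.eventually hrank] with p hp1 hp2 hp3 hp4
    have hcomp : HasFDerivAt (fun p => f (T p)) (fderiv ℝ f (T p) ∘L fderiv ℝ T p) p :=
      hp3.differentiableAt.hasFDerivAt.comp p hp1.differentiableAt.hasFDerivAt
    refine ⟨hp3.comp hp1, fun v => ?_⟩
    rw [hcomp.fderiv]
    have hLfst : L ∘L (fderiv ℝ f (T p) ∘L fderiv ℝ T p) = ContinuousLinearMap.fst ℝ Y K := by
      have h1 : HasFDerivAt (fun p => L (f (T p)))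
          (L ∘L (fderiv ℝ f (T p) ∘L fderiv ℝ T p)) p := L.hasFDerivAt.comp p hcomp
      have h2 : HasFDerivAt (fun p => L (f (T p))) (ContinuousLinearMap.fst ℝ Y K) p :=
        hasFDerivAt_fst.congr_of_eventuallyEq hp2
      exact h1.unique h2
    set R := (fderiv ℝ f (T p)).range with hR
    have hsurj : Function.Surjective ((L : F →ₗ[ℝ] Y).domRestrict R) := by
      intro u
      refine ⟨⟨fderiv ℝ f (T p) (fderiv ℝ T p (u, 0)), LinearMap.mem_range_self _ _⟩, ?_⟩
      exact DFunLike.congr_fun hLfst (u, 0)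
    have hinj : Function.Injective ((L : F →ₗ[ℝ] Y).domRestrict R) := by
      have hle := LinearMap.finrank_range_le ((L : F →ₗ[ℝ] Y).domRestrict R)
      rw [LinearMap.range_eq_top.2 hsurj, finrank_top] at hle
      exact (LinearMap.injective_iff_surjective_of_finrank_eq_finrank (le_antisymm hp4 hle)).2 hsurj
    have hz : (⟨fderiv ℝ f (T p) (fderiv ℝ T p (0, v)), LinearMap.mem_range_self _ _⟩ : R) = 0 := by
      apply hinj
      rw [map_zero]
      exact DFunLike.congr_fun hLfst (0, v)
    exact congrArg Subtype.val hz
  obtain ⟨r, hr, hball⟩ := Metric.eventually_nhds_iff_ball.1 hgood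
  have hconst : ∀ p ∈ Metric.ball p0 r, f (T p) = f (T (p.1, P x)) := by
    intro p hp
    rw [← ball_prod_same] at hp
    have hmem : ∀ v ∈ Metric.ball (P x) r, (p.1, v) ∈ Metric.ball p0 r := fun v hv => by
      rw [← ball_prod_same]
      exact ⟨hp.1, hv⟩
    have hd : ∀ v ∈ Metric.ball (P x) r, HasFDerivAt (fun v : K => f (T (p.1, v)))
        (fderiv ℝ (fun p => f (T p)) (p.1, v) ∘L ContinuousLinearMap.inr ℝ Y K) v := fun v hv =>
      HasFDerivAt.comp v (g := fun p => f (T p))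
        (hball _ (hmem v hv)).1.differentiableAt.hasFDerivAt (hasFDerivAt_prodMk_right p.1 v)
    refine Metric.isOpen_ball.is_const_of_fderiv_eq_zero (𝕜 := ℝ)
      (f := fun v : K => f (T (p.1, v))) (convex_ball (P x) r).isPreconnected
      (fun v hv => (hd v hv).differentiableAt.differentiableWithinAt) (fun v hv => ?_) hp.2
      (Metric.mem_ball_self hr)
    rw [(hd v hv).fderiv]
    ext w
    exact (hball _ (hmem v hv)).2 w
  refine ⟨fun u => f (T (u, P x)), ?_, ?_⟩
  · have h1 : AnalyticAt ℝ (fun p => f (T p)) p0 := (hball p0 (Metric.mem_ball_self hr)).1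
    exact AnalyticAt.fun_comp (f := fun u : Y => (u, P x)) h1 (by fun_prop)
  · have hc : Tendsto (fun y => (L (f y), P y)) (𝓝 x) (𝓝 p0) :=
      (hg.continuousAt.prodMk P.continuous.continuousAt)
    filter_upwards [hTl, hc.eventually (Metric.ball_mem_nhds p0 hr)] with y hy1 hy2
    have := hconst _ hy2
    rw [hy1] at this
    exact this

end ConstantRank

section Charts

open Filter

/-- The first `d` coordinates of a point of `ℝⁿ`. -/
def firstCoords {n d : ℕ} (hd : d ≤ n) : (Fin n → ℝ) →L[ℝ] (Fin d → ℝ) :=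
  ContinuousLinearMap.pi fun i => ContinuousLinearMap.proj (Fin.castLE hd i)

/-- Keep the first `d` coordinates and replace the others by zero. -/
def truncCoords (n d : ℕ) : (Fin n → ℝ) →L[ℝ] (Fin n → ℝ) :=
  ContinuousLinearMap.pi fun i => if (i : ℕ) < d then ContinuousLinearMap.proj i else 0

@[simp]
theorem firstCoords_apply {n d : ℕ} (hd : d ≤ n) (z : Fin n → ℝ) (i : Fin d) :
    firstCoords hd z i = z (Fin.castLE hd i) := rfl

theorem truncCoords_apply (n d : ℕ) (z : Fin n → ℝ) (i : Fin n) :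
    truncCoords n d z i = if (i : ℕ) < d then z i else 0 := by
  unfold truncCoords
  rw [ContinuousLinearMap.pi_apply]
  split_ifs <;> rfl

theorem truncCoords_eq_of_firstCoords_eq {n d : ℕ} (hd : d ≤ n) {z w : Fin n → ℝ}
    (h : firstCoords hd z = firstCoords hd w) : truncCoords n d z = truncCoords n d w := by
  ext i
  rw [truncCoords_apply, truncCoords_apply]
  split_ifs with hi
  · exact congrFun h ⟨i, hi⟩
  · rfl

theorem firstCoords_truncCoords {n d : ℕ} (hd : d ≤ n) (z : Fin n → ℝ) :
    firstCoords hd (truncCoords n d z) = firstCoords hd z := by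
  ext i
  rw [firstCoords_apply, truncCoords_apply, if_pos (by simp), firstCoords_apply]

theorem truncCoords_eq_self_iff {n d : ℕ} {z : Fin n → ℝ} :
    truncCoords n d z = z ↔ ∀ i : Fin n, d ≤ (i : ℕ) → z i = 0 := by
  constructor
  · intro h i hi
    rw [← h, truncCoords_apply, if_neg (by omega)]
  · intro h
    ext i
    rw [truncCoords_apply]
    split_ifs with hi
    · rfl
    · exact (h i (by omega)).symm

/-- A linear change of coordinates for which a given subspace projects onto the first coordinates. -/
theorem exists_adapted_coordinates {n : ℕ} (R : Submodule ℝ (Fin n → ℝ)) :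
    ∃ (hd : Module.finrank ℝ R ≤ n) (A : (Fin n → ℝ) ≃L[ℝ] (Fin n → ℝ)),
      ∀ u, ∃ v ∈ R, firstCoords hd (A v) = u := by
  have hd : Module.finrank ℝ R ≤ n := by simpa using R.finrank_le
  obtain ⟨C, hC⟩ := R.exists_isCompl
  have hCd : Module.finrank ℝ C = n - Module.finrank ℝ R := by
    have := Submodule.finrank_add_eq_of_isCompl hC
    rw [Module.finrank_fin_fun] at this
    omega
  let e1 : R ≃ₗ[ℝ] (Fin (Module.finrank ℝ R) → ℝ) := LinearEquiv.ofFinrankEq _ _ (by simp)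
  let e2 : C ≃ₗ[ℝ] (Fin (n - Module.finrank ℝ R) → ℝ) := LinearEquiv.ofFinrankEq _ _ (by simp [hCd])
  let e3 : Fin n ≃ Fin (Module.finrank ℝ R) ⊕ Fin (n - Module.finrank ℝ R) :=
    (finCongr (by omega)).trans finSumFinEquiv.symm
  let A := (Submodule.prodEquivOfIsCompl R C hC).symm ≪≫ₗ (e1.prodCongr e2) ≪≫ₗ
    (LinearEquiv.sumArrowLequivProdArrow _ _ ℝ ℝ).symm ≪≫ₗ LinearEquiv.funCongrLeft ℝ ℝ e3
  refine ⟨hd, A.toContinuousLinearEquiv, fun u => ⟨e1.symm u, (e1.symm u).2, ?_⟩⟩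
  ext i
  have h3 : e3 (Fin.castLE hd i) = Sum.inl i := by
    simp only [e3, Equiv.trans_apply, Equiv.symm_apply_eq]
    ext
    simp
  simp [A, LinearEquiv.funCongrLeft, h3]

/-- A set given near a point as an analytic graph over the first coordinates has a flattening
chart. -/
theorem exists_chart_of_local_graph {n d : ℕ} (hd : d ≤ n) (A : (Fin n → ℝ) ≃L[ℝ] (Fin n → ℝ))
    {S : Set (Fin n → ℝ)} {s : Fin n → ℝ} {H : (Fin d → ℝ) → (Fin n → ℝ)}
    (hH : AnalyticAt ℝ H (firstCoords hd (A s)))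
    (hS : ∀ᶠ y in 𝓝 s, y ∈ S ↔ y = H (firstCoords hd (A y)))
    (hLH : ∀ᶠ u in 𝓝 (firstCoords hd (A s)), firstCoords hd (A (H u)) = u) :
    ∃ (U V : Set (Fin n → ℝ)) (φ ψ : (Fin n → ℝ) → (Fin n → ℝ)),
      IsOpen U ∧ IsOpen V ∧ s ∈ U ∧ AnalyticOnNhd ℝ φ U ∧ AnalyticOnNhd ℝ ψ V ∧
      (∀ y ∈ U, φ y ∈ V) ∧ (∀ y ∈ V, ψ y ∈ U) ∧
      (∀ y ∈ U, ψ (φ y) = y) ∧ (∀ y ∈ V, φ (ψ y) = y) ∧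
      φ '' (U ∩ S) = V ∩ {y | ∀ i : Fin n, d ≤ (i : ℕ) → y i = 0} := by
  set q := firstCoords (n := n) (d := d) hd with hq
  set P := truncCoords n d with hP
  obtain ⟨O, hO, hOo, hsO⟩ := eventually_nhds_iff.1 hS
  obtain ⟨B, hB, hBo, hsB⟩ := eventually_nhds_iff.1 (hH.eventually_analyticAt.and hLH)
  have hqP : ∀ z, q (P z) = q z := firstCoords_truncCoords hd
  have hPq : ∀ z w, q z = q w → P z = P w := fun z w => truncCoords_eq_of_firstCoords_eq hd
  let φ : (Fin n → ℝ) → (Fin n → ℝ) := fun y => A y - (A (H (q (A y))) - P (A y))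
  let ψ : (Fin n → ℝ) → (Fin n → ℝ) := fun z => A.symm (z + (A (H (q z)) - P z))
  have hqφ : ∀ y, q (A y) ∈ B → q (φ y) = q (A y) := by
    intro y hy
    simp only [φ, map_sub, hqP, (hB _ hy).2, sub_self, sub_zero]
  have hqψ : ∀ z, q z ∈ B → q (A (ψ z)) = q z := by
    intro z hz
    simp only [ψ, ContinuousLinearEquiv.apply_symm_apply, map_add, map_sub, hqP, (hB _ hz).2,
      sub_self, add_zero]
  have hψφ : ∀ y, q (A y) ∈ B → ψ (φ y) = y := by
    intro y hy
    have : ψ (φ y) = A.symm (φ y + (A (H (q (φ y))) - P (φ y))) := rfl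
    rw [this, hPq _ _ (hqφ y hy), hqφ y hy]
    simp [φ]
  have hφψ : ∀ z, q z ∈ B → φ (ψ z) = z := by
    intro z hz
    have : φ (ψ z) = A (ψ z) - (A (H (q (A (ψ z)))) - P (A (ψ z))) := rfl
    rw [this, hPq _ _ (hqψ z hz), hqψ z hz]
    simp [ψ]
  have hBq : IsOpen {z : Fin n → ℝ | q z ∈ B} := hBo.preimage q.continuous
  have hHq : ∀ z, q z ∈ B → AnalyticAt ℝ (fun z => H (q z)) z := fun z hz =>
    (hB _ hz).1.fun_comp (q.analyticAt z)
  have hφa : ∀ y, q (A y) ∈ B → AnalyticAt ℝ φ y := by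
    intro y hy
    have h0 : AnalyticAt ℝ (fun z => z - (A (H (q z)) - P z)) (A y) :=
      analyticAt_id.fun_sub ((((A : (Fin n → ℝ) →L[ℝ] (Fin n → ℝ)).analyticAt _).fun_comp
        (hHq _ hy)).fun_sub (P.analyticAt _))
    exact h0.fun_comp ((A : (Fin n → ℝ) →L[ℝ] (Fin n → ℝ)).analyticAt y)
  have hψa : ∀ z, q z ∈ B → AnalyticAt ℝ ψ z := by
    intro z hz
    have h0 : AnalyticAt ℝ (fun z => z + (A (H (q z)) - P z)) z :=
      analyticAt_id.fun_add ((((A : (Fin n → ℝ) →L[ℝ] (Fin n → ℝ)).analyticAt _).fun_comp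
        (hHq _ hz)).fun_sub (P.analyticAt _))
    exact ((A.symm : (Fin n → ℝ) →L[ℝ] (Fin n → ℝ)).analyticAt _).fun_comp h0
  have hflat : ∀ y ∈ O, q (A y) ∈ B →
      (y ∈ S ↔ ∀ i : Fin n, d ≤ (i : ℕ) → φ y i = 0) := by
    intro y hyO hyB
    rw [hO y hyO, ← truncCoords_eq_self_iff, ← hP, hPq _ _ (hqφ y hyB), ← A.injective.eq_iff]
    simp only [φ]
    constructor
    · intro h
      rw [← h]
      simp
    · intro h
      ext i
      have hi := congrFun h i
      simp only [Pi.sub_apply] at hi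
      linarith
  refine ⟨O ∩ {y | q (A y) ∈ B}, {z | q z ∈ B} ∩ ψ ⁻¹' O, φ, ψ,
    hOo.inter (hBq.preimage A.continuous), ?_, ⟨hsO, hsB⟩, fun y hy => hφa y hy.2,
    fun z hz => hψa z hz.1, ?_, fun z hz => ⟨hz.2, ?_⟩, fun y hy => hψφ y hy.2,
    fun z hz => hφψ z hz.1, ?_⟩
  · exact ContinuousOn.isOpen_inter_preimage
      (fun z hz => (hψa z hz).continuousAt.continuousWithinAt) hBq hOo
  · rintro y ⟨hyO, hyB⟩
    refine ⟨?_, ?_⟩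
    · change q (φ y) ∈ B
      rw [hqφ y hyB]
      exact hyB
    · change ψ (φ y) ∈ O
      rw [hψφ y hyB]
      exact hyO
  · change q (A (ψ z)) ∈ B
    rw [hqψ z hz.1]
    exact hz.1
  · ext z
    constructor
    · rintro ⟨y, ⟨⟨hyO, hyB⟩, hyS⟩, rfl⟩
      refine ⟨⟨?_, ?_⟩, (hflat y hyO hyB).1 hyS⟩
      · change q (φ y) ∈ B
        rw [hqφ y hyB]
        exact hyB
      · change ψ (φ y) ∈ O
        rw [hψφ y hyB]
        exact hyO
    · rintro ⟨⟨hzB, hzO⟩, hz⟩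
      have hB' : q (A (ψ z)) ∈ B := by
        rw [hqψ z hzB]
        exact hzB
      refine ⟨ψ z, ⟨⟨hzO, hB'⟩, (hflat _ hzO hB').2 ?_⟩, hφψ z hzB⟩
      rw [hφψ z hzB]
      exact hz

end Charts

section LocallyAnalytic

open Filter

variable {E F F' : Type*} [NormedAddCommGroup E] [NormedSpace ℝ E]
  [NormedAddCommGroup F] [NormedSpace ℝ F] [NormedAddCommGroup F'] [NormedSpace ℝ F']

/-- `f` is near each point of `S` the restriction to `S` of an analytic map. -/
def IsLocAnalytic (S : Set E) (f : E → F) : Prop :=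
  ∀ x ∈ S, ∃ g : E → F, AnalyticAt ℝ g x ∧ ∀ᶠ y in 𝓝 x, y ∈ S → g y = f y

theorem IsLocAnalytic.continuousOn {S : Set E} {f : E → F} (hf : IsLocAnalytic S f) :
    ContinuousOn f S := by
  intro x hx
  obtain ⟨g, hg, hgf⟩ := hf x hx
  exact hg.continuousAt.continuousWithinAt.congr_of_eventuallyEq
    ((eventually_nhdsWithin_iff.2 hgf).mono fun y hy => hy.symm) (hgf.self_of_nhds hx).symm

theorem AnalyticOnNhd.isLocAnalytic {S : Set E} {f : E → F} (hf : AnalyticOnNhd ℝ f S) :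
    IsLocAnalytic S f :=
  fun x hx => ⟨f, hf x hx, Eventually.of_forall fun _ _ => rfl⟩

theorem IsLocAnalytic.comp {S : Set E} {T : Set F} {g : F → F'} {f : E → F}
    (hg : IsLocAnalytic T g) (hf : IsLocAnalytic S f) (h : MapsTo f S T) :
    IsLocAnalytic S (fun x => g (f x)) := by
  intro x hx
  obtain ⟨f', hf', hff'⟩ := hf x hx
  obtain ⟨g', hg', hgg'⟩ := hg _ (h hx)
  have hfx : f' x = f x := hff'.self_of_nhds hx
  rw [← hfx] at hg' hgg'
  refine ⟨fun y => g' (f' y), hg'.fun_comp hf', ?_⟩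
  filter_upwards [hff', hf'.continuousAt.tendsto.eventually hgg'] with y h1 h2 hy
  rw [h2 (by rw [h1 hy]; exact h hy), h1 hy]

theorem IsLocAnalytic.prodMk {S : Set E} {f : E → F} {g : E → F'}
    (hf : IsLocAnalytic S f) (hg : IsLocAnalytic S g) :
    IsLocAnalytic S (fun x => (f x, g x)) := by
  intro x hx
  obtain ⟨f', hf', hff'⟩ := hf x hx
  obtain ⟨g', hg', hgg'⟩ := hg x hx
  refine ⟨fun y => (f' y, g' y), hf'.prod hg', ?_⟩
  filter_upwards [hff', hgg'] with y h1 h2 hy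
  rw [h1 hy, h2 hy]

theorem IsLocAnalytic.congr {S : Set E} {f g : E → F} (hf : IsLocAnalytic S f)
    (h : ∀ x ∈ S, f x = g x) : IsLocAnalytic S g := fun x hx => by
  obtain ⟨f', hf', hff'⟩ := hf x hx
  exact ⟨f', hf', hff'.mono fun y hy hyS => (hy hyS).trans (h y hyS)⟩

theorem locAnalyticOn_iff_isLocAnalytic {n m : ℕ} {S : Set (Fin n → ℝ)}
    {f : (Fin n → ℝ) → (Fin m → ℝ)} : LocAnalyticOn S f ↔ IsLocAnalytic S f := by
  constructor
  · intro h x hx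
    obtain ⟨U, hU, hxU, g, hg, hgf⟩ := h x hx
    exact ⟨g, hg x hxU, eventually_of_mem (hU.mem_nhds hxU) fun y hy hyS => hgf y ⟨hy, hyS⟩⟩
  · intro h x hx
    obtain ⟨g, hg, hgf⟩ := h x hx
    obtain ⟨U, hU, hUo, hxU⟩ := eventually_nhds_iff.1 (hg.eventually_analyticAt.and hgf)
    exact ⟨U, hUo, hxU, g, fun y hy => (hU y hy).1, fun y hy => (hU y hy.1).2 hy.2⟩

/-- `ρ` is an analytic local retraction onto `S` around `x`. -/
structure IsRetractionAt (S : Set E) (ρ : E → E) (x : E) : Prop where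
  analyticAt : AnalyticAt ℝ ρ x
  mem : ∀ᶠ y in 𝓝 x, ρ y ∈ S
  fix : ∀ᶠ y in 𝓝 x, y ∈ S → ρ y = y

namespace IsRetractionAt

variable {S : Set E} {ρ : E → E} {x : E}

theorem apply_self (h : IsRetractionAt S ρ x) (hx : x ∈ S) : ρ x = x := h.fix.self_of_nhds hx

theorem tendsto (h : IsRetractionAt S ρ x) (hx : x ∈ S) : Tendsto ρ (𝓝 x) (𝓝 x) := by
  have := h.analyticAt.continuousAt.tendsto
  rwa [h.apply_self hx] at this

theorem eventually [CompleteSpace E] (h : IsRetractionAt S ρ x) :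
    ∀ᶠ y in 𝓝 x, IsRetractionAt S ρ y := by
  filter_upwards [h.analyticAt.eventually_analyticAt, h.mem.eventually_nhds,
    h.fix.eventually_nhds] with y h1 h2 h3
  exact ⟨h1, h2, h3⟩

theorem analyticAt_comp (h : IsRetractionAt S ρ x) (hx : x ∈ S) {f : E → F}
    (hf : IsLocAnalytic S f) : AnalyticAt ℝ (fun y => f (ρ y)) x := by
  obtain ⟨g, hg, hgf⟩ := hf x hx
  rw [← h.apply_self hx] at hg
  refine (hg.fun_comp h.analyticAt).congr ?_
  filter_upwards [h.mem, (h.tendsto hx).eventually hgf] with y h1 h2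
  exact h2 h1

end IsRetractionAt

theorem IsAnalyticSubmanifold.exists_isRetractionAt {n d : ℕ} {S : Set (Fin n → ℝ)}
    (hS : IsAnalyticSubmanifold d S) {x : Fin n → ℝ} (hx : x ∈ S) :
    ∃ ρ, IsRetractionAt S ρ x := by
  obtain ⟨U, V, φ, ψ, hU, hV, hxU, hφ, hψ, hUV, hVU, hψφ, hφψ, him⟩ := hS x hx
  have hφS : ∀ y ∈ U, y ∈ S → truncCoords n d (φ y) = φ y := fun y hy hyS =>
    truncCoords_eq_self_iff.2 (him.subset ⟨y, ⟨hy, hyS⟩, rfl⟩).2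
  have hx' := hφS x hxU hx
  have hTφ : AnalyticAt ℝ (fun y => truncCoords n d (φ y)) x :=
    ((truncCoords n d).analyticAt _).fun_comp (hφ x hxU)
  refine ⟨fun y => ψ (truncCoords n d (φ y)), ?_, ?_, ?_⟩
  · refine AnalyticAt.fun_comp (g := ψ) ?_ hTφ
    rw [hx']
    exact hψ _ (hUV x hxU)
  · have hV' : ∀ᶠ y in 𝓝 x, truncCoords n d (φ y) ∈ V := by
      refine hTφ.continuousAt.tendsto.eventually (hV.mem_nhds ?_)
      rw [hx']
      exact hUV x hxU
    filter_upwards [hV'] with y hy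
    have hmem : truncCoords n d (φ y) ∈ φ '' (U ∩ S) := by
      rw [him]
      refine ⟨hy, truncCoords_eq_self_iff.1 ?_⟩
      ext i
      simp only [truncCoords_apply]
      split_ifs <;> rfl
    obtain ⟨w, ⟨hwU, hwS⟩, hw⟩ := hmem
    change ψ (truncCoords n d (φ y)) ∈ S
    rw [← hw, hψφ w hwU]
    exact hwS
  · filter_upwards [hU.mem_nhds hxU] with y hy hyS
    rw [hφS y hy hyS, hψφ y hy]

end LocallyAnalytic

section AnalyticGroups

open Filter

/-- A group whose underlying set lies in a normed space and whose operations are locally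
restrictions of analytic maps. -/
structure AnalyticGroup (E : Type*) [NormedAddCommGroup E] [NormedSpace ℝ E] where
  carrier : Set E
  one : E
  mul : E → E → E
  inv : E → E
  one_mem : one ∈ carrier
  mul_mem : ∀ x ∈ carrier, ∀ y ∈ carrier, mul x y ∈ carrier
  inv_mem : ∀ x ∈ carrier, inv x ∈ carrier
  mul_assoc : ∀ x ∈ carrier, ∀ y ∈ carrier, ∀ z ∈ carrier, mul (mul x y) z = mul x (mul y z)
  one_mul : ∀ x ∈ carrier, mul one x = x
  inv_mul_cancel : ∀ x ∈ carrier, mul (inv x) x = one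
  mul_analytic : IsLocAnalytic (carrier ×ˢ carrier) fun p : E × E => mul p.1 p.2
  inv_analytic : IsLocAnalytic carrier inv

variable {E F : Type*} [NormedAddCommGroup E] [NormedSpace ℝ E]
  [NormedAddCommGroup F] [NormedSpace ℝ F]

namespace AnalyticGroup

variable (G : AnalyticGroup E)

instance : Mul G.carrier := ⟨fun x y => ⟨G.mul x y, G.mul_mem x x.2 y y.2⟩⟩
instance : Inv G.carrier := ⟨fun x => ⟨G.inv x, G.inv_mem x x.2⟩⟩
instance : One G.carrier := ⟨⟨G.one, G.one_mem⟩⟩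

instance : Group G.carrier :=
  Group.ofLeftAxioms (fun a b c => Subtype.ext (G.mul_assoc a a.2 b b.2 c c.2))
    (fun a => Subtype.ext (G.one_mul a a.2)) (fun a => Subtype.ext (G.inv_mul_cancel a a.2))

instance : IsTopologicalGroup G.carrier where
  continuous_mul := by
    refine Continuous.subtype_mk ?_ _
    exact G.mul_analytic.continuousOn.comp_continuous
      (f := fun p : G.carrier × G.carrier => ((p.1 : E), (p.2 : E))) (by fun_prop)
      fun p => ⟨p.1.2, p.2.2⟩
  continuous_inv := by
    refine Continuous.subtype_mk ?_ _
    exact G.inv_analytic.continuousOn.comp_continuous continuous_subtype_val fun p => p.2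

theorem mul_left_isLocAnalytic {k : E} (hk : k ∈ G.carrier) :
    IsLocAnalytic G.carrier (G.mul k) :=
  G.mul_analytic.comp (f := fun y => (k, y))
    (AnalyticOnNhd.isLocAnalytic fun _ _ => analyticAt_const.prod analyticAt_id)
    fun _ hy => ⟨hk, hy⟩

theorem locallyCompactSpace [FiniteDimensional ℝ E]
    (h : ∃ x ∈ G.carrier, ∃ U, IsOpen U ∧ x ∈ U ∧ ∃ Z, IsClosed Z ∧ G.carrier ∩ U = Z ∩ U) :
    LocallyCompactSpace G.carrier := by
  have := FiniteDimensional.proper ℝ E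
  obtain ⟨x, hx, U, hU, hxU, Z, hZ, hSZ⟩ := h
  obtain ⟨ε, hε, hεU⟩ := Metric.nhds_basis_closedBall.mem_iff.1 (hU.mem_nhds hxU)
  have hcl : Metric.closedBall x ε ∩ G.carrier = Metric.closedBall x ε ∩ Z := by
    ext y
    refine and_congr_right fun hy => ?_
    have := Set.ext_iff.1 hSZ y
    simpa [hεU hy] using this
  have hK : IsCompact ((↑) ⁻¹' Metric.closedBall x ε : Set G.carrier) := by
    rw [Subtype.isCompact_iff, Subtype.image_preimage_coe, inter_comm, hcl]
    exact (isCompact_closedBall x ε).inter_right hZ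
  exact hK.locallyCompactSpace_of_mem_nhds_of_group (x := ⟨x, hx⟩)
    (continuous_subtype_val.continuousAt.preimage_mem_nhds (Metric.closedBall_mem_nhds x hε))

end AnalyticGroup

/-- A homomorphism of analytic groups which is locally the restriction of an analytic map. -/
structure IsAnalyticHom (G : AnalyticGroup E) (Q : AnalyticGroup F) (π : E → F) : Prop where
  mapsTo : MapsTo π G.carrier Q.carrier
  map_mul : ∀ x ∈ G.carrier, ∀ y ∈ G.carrier, π (G.mul x y) = Q.mul (π x) (π y)
  analytic : IsLocAnalytic G.carrier π

namespace IsAnalyticHom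

variable {G : AnalyticGroup E} {Q : AnalyticGroup F} {π : E → F}

/-- The underlying homomorphism of abstract groups. -/
def toMonoidHom (h : IsAnalyticHom G Q π) : G.carrier →* Q.carrier :=
  MonoidHom.mk' (fun x => ⟨π x, h.mapsTo x.2⟩) fun x y => Subtype.ext (h.map_mul x x.2 y y.2)

theorem map_one (h : IsAnalyticHom G Q π) : π G.one = Q.one :=
  congrArg Subtype.val h.toMonoidHom.map_one

theorem map_inv (h : IsAnalyticHom G Q π) {x : E} (hx : x ∈ G.carrier) :
    π (G.inv x) = Q.inv (π x) :=
  congrArg Subtype.val (h.toMonoidHom.map_inv ⟨x, hx⟩)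

/-- Surjective homomorphisms are open. -/
theorem eventually_nhdsWithin_of_surjOn [FiniteDimensional ℝ E] [FiniteDimensional ℝ F]
    (h : IsAnalyticHom G Q π) (hsurj : SurjOn π G.carrier Q.carrier)
    (hG : ∃ x ∈ G.carrier, ∃ U, IsOpen U ∧ x ∈ U ∧ ∃ Z, IsClosed Z ∧ G.carrier ∩ U = Z ∩ U)
    (hQ : ∃ x ∈ Q.carrier, ∃ U, IsOpen U ∧ x ∈ U ∧ ∃ Z, IsClosed Z ∧ Q.carrier ∩ U = Z ∩ U)
    {g : E} (hg : g ∈ G.carrier) {p : F → Prop} (hp : ∀ᶠ x in 𝓝[G.carrier] g, p (π x)) :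
    ∀ᶠ y in 𝓝[Q.carrier] π g, p y := by
  have := FiniteDimensional.proper ℝ E
  have := G.locallyCompactSpace hG
  have := Q.locallyCompactSpace hQ
  have : SigmaCompactSpace G.carrier := sigmaCompactSpace_of_locallyCompact_secondCountable
  have hopen : IsOpenMap h.toMonoidHom := by
    refine MonoidHom.isOpenMap_of_sigmaCompact _ ?_ ?_
    · rintro ⟨y, hy⟩
      obtain ⟨x, hx, rfl⟩ := hsurj hy
      exact ⟨⟨x, hx⟩, rfl⟩
    · exact (h.analytic.continuousOn.comp_continuous continuous_subtype_val
        fun x => x.2).subtype_mk _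
  have hm := hopen.nhds_le ⟨g, hg⟩
  rw [← map_nhds_subtype_val ⟨g, hg⟩, eventually_map] at hp
  change ∀ᶠ y in 𝓝[Q.carrier] (h.toMonoidHom ⟨g, hg⟩ : F), p y
  rw [← map_nhds_subtype_val (h.toMonoidHom ⟨g, hg⟩), eventually_map]
  exact hm (eventually_map.2 hp)

end IsAnalyticHom

end AnalyticGroups

section Rank

open Filter Module

variable {E F F' : Type*} [NormedAddCommGroup E] [NormedSpace ℝ E] [FiniteDimensional ℝ E]
  [NormedAddCommGroup F] [NormedSpace ℝ F]
  [NormedAddCommGroup F'] [NormedSpace ℝ F'] [FiniteDimensional ℝ F']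

theorem ContinuousLinearMap.finrank_range_comp_le {V₁ V₂ V₃ : Type*}
    [NormedAddCommGroup V₁] [NormedSpace ℝ V₁] [NormedAddCommGroup V₂] [NormedSpace ℝ V₂]
    [FiniteDimensional ℝ V₂] [NormedAddCommGroup V₃] [NormedSpace ℝ V₃] [FiniteDimensional ℝ V₃]
    (g : V₂ →L[ℝ] V₃) (f : V₁ →L[ℝ] V₂) :
    finrank ℝ (g ∘L f).range ≤ finrank ℝ f.range ∧
      finrank ℝ (g ∘L f).range ≤ finrank ℝ g.range := by
  constructor
  · have : (g ∘L f).range = f.range.map (g : V₂ →ₗ[ℝ] V₃) := LinearMap.range_comp _ _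
    rw [this]
    exact Submodule.finrank_map_le _ _
  · exact Submodule.finrank_mono (LinearMap.range_comp_le_range _ _)

namespace IsAnalyticHom

variable {G : AnalyticGroup E} {Q : AnalyticGroup F} {π : E → F}

/-- The rank of a homomorphism does not depend on the point or on the retraction. -/
theorem finrank_range_fderiv_le [FiniteDimensional ℝ F] (h : IsAnalyticHom G Q π) {a b : E}
    (ha : a ∈ G.carrier)
    (hb : b ∈ G.carrier) {ρ σ : E → E} (hρ : IsRetractionAt G.carrier ρ a)
    (hσ : IsRetractionAt G.carrier σ b) :
    finrank ℝ (fderiv ℝ (fun y => π (ρ y)) a).range ≤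
      finrank ℝ (fderiv ℝ (fun y => π (σ y)) b).range := by
  set k : G.carrier := ⟨b, hb⟩ * ⟨a, ha⟩⁻¹ with hk
  let Λ : E → E := fun y => G.mul k (ρ y)
  have hΛ : AnalyticAt ℝ Λ a := hρ.analyticAt_comp ha (G.mul_left_isLocAnalytic k.2)
  have hΛa : Λ a = b := by
    have : (k * ⟨a, ha⟩ : G.carrier) = ⟨b, hb⟩ := by simp [hk]
    simp only [Λ, hρ.apply_self ha]
    exact congrArg Subtype.val this
  have hπσ : AnalyticAt ℝ (fun y => π (σ y)) b := hσ.analyticAt_comp hb h.analytic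
  have hΛt : Tendsto Λ (𝓝 a) (𝓝 b) := hΛa ▸ hΛ.continuousAt.tendsto
  have hπb : π (σ b) = π b := by rw [hσ.apply_self hb]
  obtain ⟨M, hM, hMeq⟩ :=
    (Q.mul_left_isLocAnalytic (h.toMonoidHom k⁻¹).2) (π b) (h.mapsTo hb)
  have heq : (fun y => π (ρ y)) =ᶠ[𝓝 a] fun y => M (π (σ (Λ y))) := by
    have h1 : Tendsto (fun y => π (σ (Λ y))) (𝓝 a) (𝓝 (π b)) := by
      have := hπσ.continuousAt.tendsto
      rw [hπb] at this
      exact this.comp hΛt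
    filter_upwards [h1.eventually hMeq, hρ.mem, hΛt.eventually hσ.fix] with y h1 h2 h3
    have h4 : Λ y ∈ G.carrier := G.mul_mem _ k.2 _ h2
    rw [h3 h4] at h1 ⊢
    rw [h1 (h.mapsTo h4)]
    have : (⟨ρ y, h2⟩ : G.carrier) = k⁻¹ * (k * ⟨ρ y, h2⟩) := by group
    have h5 := congrArg h.toMonoidHom this
    rw [_root_.map_mul] at h5
    exact congrArg Subtype.val h5
  rw [heq.fderiv_eq]
  have hd1 : HasFDerivAt (fun y => π (σ y)) (fderiv ℝ (fun y => π (σ y)) b) (Λ a) := by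
    rw [hΛa]
    exact hπσ.differentiableAt.hasFDerivAt
  have hd2 : HasFDerivAt M (fderiv ℝ M (π b)) (π (σ (Λ a))) := by
    rw [hΛa, hπb]
    exact hM.differentiableAt.hasFDerivAt
  have hd := hd2.comp a (hd1.comp a hΛ.differentiableAt.hasFDerivAt)
  have hd' := hd.fderiv
  change fderiv ℝ (fun y => M (π (σ (Λ y)))) a = _ at hd'
  rw [hd']
  exact (ContinuousLinearMap.finrank_range_comp_le _ _).1.trans
    (ContinuousLinearMap.finrank_range_comp_le _ _).2

theorem eventually_finrank_range_fderiv_le [FiniteDimensional ℝ F]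
    (h : IsAnalyticHom G Q π) {a b : E}
    (ha : a ∈ G.carrier) (hb : b ∈ G.carrier) {ρ σ : E → E}
    (hρ : IsRetractionAt G.carrier ρ a) (hσ : IsRetractionAt G.carrier σ b) :
    ∀ᶠ y in 𝓝 a, finrank ℝ (fderiv ℝ (fun y => π (ρ y)) y).range ≤
      finrank ℝ (fderiv ℝ (fun y => π (σ y)) b).range := by
  have := FiniteDimensional.complete ℝ E
  have h1 : ∀ᶠ y in 𝓝 a, ρ (ρ y) = ρ y := by
    filter_upwards [hρ.mem, (hρ.tendsto ha).eventually hρ.fix] with y h1 h2 using h2 h1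
  filter_upwards [h1.eventually_nhds, hρ.mem, hρ.eventually,
    (hρ.tendsto ha).eventually hρ.eventually] with y hy1 hy2 hy3 hy4
  have heq : (fun y => π (ρ y)) =ᶠ[𝓝 y] fun y => π (ρ (ρ y)) := by
    filter_upwards [hy1] with z hz
    rw [hz]
  have hd := ((hy4.analyticAt_comp hy2 h.analytic).differentiableAt.hasFDerivAt.comp y
    hy3.analyticAt.differentiableAt.hasFDerivAt).fderiv
  change fderiv ℝ (fun y => π (ρ (ρ y))) y = _ at hd
  rw [heq.fderiv_eq, hd]
  exact (ContinuousLinearMap.finrank_range_comp_le _ _).2.trans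
    (h.finrank_range_fderiv_le hy2 hb hy4 hσ)

/-- If `Φ` dominates `π` but does not have larger rank, then `Φ` is locally constant on the
kernel of `π`. -/
theorem eventually_eq_of_finrank_le {Q' : AnalyticGroup F'} {Φ : E → F'}
    (hΦ : IsAnalyticHom G Q' Φ) (pr : F' →L[ℝ] F)
    (hpr : ∀ x ∈ G.carrier, pr (Φ x) = π x) {ρ : E → E}
    (hρ : IsRetractionAt G.carrier ρ G.one)
    (hrank : finrank ℝ (fderiv ℝ (fun y => Φ (ρ y)) G.one).range ≤
      finrank ℝ (fderiv ℝ (fun y => π (ρ y)) G.one).range) :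
    ∀ᶠ y in 𝓝[G.carrier] G.one, π y = π G.one → Φ y = Φ G.one := by
  have h1 := G.one_mem
  set R := (fderiv ℝ (fun y => π (ρ y)) G.one).range with hR
  obtain ⟨P, hP⟩ := Submodule.ClosedComplemented.of_finiteDimensional R
  have hΦa : AnalyticAt ℝ (fun y => Φ (ρ y)) G.one := hρ.analyticAt_comp h1 hΦ.analytic
  have heq : (fun y => pr (Φ (ρ y))) =ᶠ[𝓝 G.one] fun y => π (ρ y) := by
    filter_upwards [hρ.mem] with y hy using hpr _ hy
  have hder : pr ∘L fderiv ℝ (fun y => Φ (ρ y)) G.one = fderiv ℝ (fun y => π (ρ y)) G.one := by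
    rw [← heq.fderiv_eq]
    exact (pr.hasFDerivAt.comp G.one hΦa.differentiableAt.hasFDerivAt).fderiv.symm
  have hsurj : ((P ∘L pr) ∘L fderiv ℝ (fun y => Φ (ρ y)) G.one).range = ⊤ := by
    rw [ContinuousLinearMap.comp_assoc, hder]
    refine LinearMap.range_eq_top.2 fun v => ?_
    obtain ⟨w, hw⟩ := LinearMap.mem_range.1 v.2
    exact ⟨w, by simpa [← hw] using hP v⟩
  obtain ⟨H, -, hH⟩ := hΦa.exists_factor_of_rank_le (P ∘L pr) hsurj
    ((hΦ.eventually_finrank_range_fderiv_le h1 h1 hρ hρ).mono fun y hy => hy.trans hrank)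
  have hH1 := hH.self_of_nhds
  simp only [ContinuousLinearMap.comp_apply, hρ.apply_self h1, hpr _ h1] at hH1
  refine eventually_nhdsWithin_iff.2 ?_
  filter_upwards [hH, hρ.fix] with y hy1 hy2 hyG hyπ
  simp only [ContinuousLinearMap.comp_apply, hy2 hyG, hpr _ hyG] at hy1
  rw [hy1, hyπ, ← hH1]

end IsAnalyticHom

/-- The image of a homomorphism is a submanifold. -/
theorem IsAnalyticHom.isAnalyticSubmanifold {n m : ℕ} {G : AnalyticGroup (Fin n → ℝ)}
    {Q : AnalyticGroup (Fin m → ℝ)} {π : (Fin n → ℝ) → (Fin m → ℝ)} (h : IsAnalyticHom G Q π)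
    (hsurj : SurjOn π G.carrier Q.carrier)
    (hG : ∃ x ∈ G.carrier, ∃ U, IsOpen U ∧ x ∈ U ∧ ∃ Z, IsClosed Z ∧ G.carrier ∩ U = Z ∩ U)
    (hQ : ∃ x ∈ Q.carrier, ∃ U, IsOpen U ∧ x ∈ U ∧ ∃ Z, IsClosed Z ∧ Q.carrier ∩ U = Z ∩ U)
    (hret : ∀ x ∈ G.carrier, ∃ ρ, IsRetractionAt G.carrier ρ x) :
    ∃ d, IsAnalyticSubmanifold d Q.carrier := by
  obtain ⟨σ, hσ⟩ := hret _ G.one_mem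
  refine ⟨finrank ℝ (fderiv ℝ (fun y => π (σ y)) G.one).range, fun s hs => ?_⟩
  obtain ⟨g, hg, rfl⟩ := hsurj hs
  obtain ⟨ρ, hρ⟩ := hret g hg
  rw [← (h.finrank_range_fderiv_le hg G.one_mem hρ hσ).antisymm
    (h.finrank_range_fderiv_le G.one_mem hg hσ hρ)]
  have ha : AnalyticAt ℝ (fun y => π (ρ y)) g := hρ.analyticAt_comp hg h.analytic
  have hρg : ρ g = g := hρ.apply_self hg
  obtain ⟨hd, A, hA⟩ := exists_adapted_coordinates (fderiv ℝ (fun y => π (ρ y)) g).range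
  set d := finrank ℝ (fderiv ℝ (fun y => π (ρ y)) g).range with hdd
  let L : (Fin m → ℝ) →L[ℝ] (Fin d → ℝ) := firstCoords hd ∘L (A : (Fin m → ℝ) →L[ℝ] (Fin m → ℝ))
  have hLs : (L ∘L fderiv ℝ (fun y => π (ρ y)) g).range = ⊤ := by
    refine LinearMap.range_eq_top.2 fun u => ?_
    obtain ⟨v, ⟨w, rfl⟩, hw⟩ := hA u
    exact ⟨w, hw⟩
  obtain ⟨H, hH, hfac⟩ := ha.exists_factor_of_rank_le L hLs
    ((h.eventually_finrank_range_fderiv_le hg hg hρ hρ).mono fun y hy => by simpa using hy)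
  have hsub : ∀ᶠ u in 𝓝 (L (π g)), H u ∈ Q.carrier ∧ L (H u) = u := by
    have hstrict : HasStrictFDerivAt (fun y => L (π (ρ y)))
        (L ∘L fderiv ℝ (fun y => π (ρ y)) g) g :=
      L.hasStrictFDerivAt.comp g ha.hasStrictFDerivAt
    have hmap := hstrict.map_nhds_eq_of_surj hLs
    rw [hρg] at hmap
    rw [← hmap, eventually_map]
    filter_upwards [hfac, hρ.mem] with y h1 h2
    rw [← h1]
    exact ⟨h.mapsTo h2, rfl⟩
  simp only [hρg] at hH
  have hLt : Tendsto L (𝓝 (π g)) (𝓝 (L (π g))) := L.continuous.tendsto _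
  refine exists_chart_of_local_graph hd A (s := π g) (H := H) hH ?_ (hsub.mono fun u hu => hu.2)
  have hopen : ∀ᶠ y in 𝓝[Q.carrier] π g, y = H (L y) := by
    refine h.eventually_nhdsWithin_of_surjOn hsurj hG hQ hg (p := fun y => y = H (L y)) ?_
    refine eventually_nhdsWithin_iff.2 ?_
    filter_upwards [hfac, hρ.fix] with y h1 h2 h3
    rwa [h2 h3] at h1
  filter_upwards [eventually_nhdsWithin_iff.1 hopen, hLt.eventually hsub] with y h1 h2
  exact ⟨h1, fun h3 => by rw [h3]; exact h2.1⟩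

end Rank

section Graphs

theorem frontHalf_append {n m : ℕ} (x : Fin n → ℝ) (y : Fin m → ℝ) :
    frontHalf (Fin.append x y) = x := funext fun i => Fin.append_left x y i

theorem backHalf_append {n m : ℕ} (x : Fin n → ℝ) (y : Fin m → ℝ) :
    backHalf (Fin.append x y) = y := funext fun i => Fin.append_right x y i

theorem append_frontHalf_backHalf {n m : ℕ} (z : Fin (n + m) → ℝ) :
    Fin.append (frontHalf z) (backHalf z) = z := Fin.append_castAdd_natAdd

theorem eq_append_iff {n m : ℕ} {z : Fin (n + m) → ℝ} {x : Fin n → ℝ} {y : Fin m → ℝ} :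
    z = Fin.append x y ↔ frontHalf z = x ∧ backHalf z = y := by
  constructor
  · rintro rfl
    exact ⟨frontHalf_append x y, backHalf_append x y⟩
  · rintro ⟨rfl, rfl⟩
    exact (append_frontHalf_backHalf z).symm

theorem mem_nashGraph {n m : ℕ} {S : Set (Fin n → ℝ)} {f : (Fin n → ℝ) → (Fin m → ℝ)}
    {z : Fin (n + m) → ℝ} :
    z ∈ NashGraph S f ↔ frontHalf z ∈ S ∧ backHalf z = f (frontHalf z) := by
  simp only [NashGraph, mem_ofPred_eq, eq_append_iff]
  constructor
  · rintro ⟨x, hx, rfl, h⟩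
    exact ⟨hx, h⟩
  · rintro ⟨hx, h⟩
    exact ⟨_, hx, rfl, h⟩

theorem isSignDetermined_of_nashGraph {n m : ℕ} {S : Set (Fin n → ℝ)}
    {f : (Fin n → ℝ) → (Fin m → ℝ)} (h : IsSemialgebraic (NashGraph S f)) {σ : Type*}
    (a : Fin n → σ) (b : Fin m → σ) :
    IsSignDetermined {w : σ → ℝ | w ∘ a ∈ S ∧ w ∘ b = f (w ∘ a)} := by
  convert h.isSignDetermined.preimage_comp (Fin.append a b) using 1
  ext w
  have h1 : frontHalf (w ∘ Fin.append a b) = w ∘ a := by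
    ext i
    simp [frontHalf]
  have h2 : backHalf (w ∘ Fin.append a b) = w ∘ b := by
    ext i
    simp [backHalf]
  simp only [mem_ofPred_eq, mem_nashGraph, h1, h2]

theorem isSemialgebraic_nashGraph_of {n m : ℕ} {S : Set (Fin n → ℝ)}
    {f : (Fin n → ℝ) → (Fin m → ℝ)} {T : Set (Fin (n + m) → ℝ)} (hT : IsSignDetermined T)
    (h : ∀ w, w ∈ T ↔ w ∘ Fin.castAdd m ∈ S ∧ w ∘ Fin.natAdd n = f (w ∘ Fin.castAdd m)) :
    IsSemialgebraic (NashGraph S f) := by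
  have : NashGraph S f = T := by
    ext w
    rw [h, mem_nashGraph]
    rfl
  rw [this]
  exact hT.isSemialgebraic

theorem NashGroup.isSignDetermined_mul (G : NashGroup) {σ : Type*} (a b c : Fin G.n → σ) :
    IsSignDetermined {w : σ → ℝ | (w ∘ a ∈ G.carrier ∧ w ∘ b ∈ G.carrier) ∧
      w ∘ c = G.mul (w ∘ a) (w ∘ b)} := by
  convert isSignDetermined_of_nashGraph G.mul_nash.2 (Fin.append a b) c using 1
  ext w
  have h1 : frontHalf (w ∘ Fin.append a b) = w ∘ a :=
    funext fun i => congrArg w (Fin.append_left a b i)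
  have h2 : backHalf (w ∘ Fin.append a b) = w ∘ b :=
    funext fun i => congrArg w (Fin.append_right a b i)
  simp only [mem_ofPred_eq, h1, h2]

/-- Concatenation of vectors, as a continuous linear map. -/
def appendCLM (n m : ℕ) : (Fin n → ℝ) × (Fin m → ℝ) →L[ℝ] (Fin (n + m) → ℝ) :=
  ContinuousLinearMap.pi (Fin.append
    (fun i => ContinuousLinearMap.proj i ∘L ContinuousLinearMap.fst ℝ _ _)
    (fun i => ContinuousLinearMap.proj i ∘L ContinuousLinearMap.snd ℝ _ _))

theorem appendCLM_apply {n m : ℕ} (p : (Fin n → ℝ) × (Fin m → ℝ)) :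
    appendCLM n m p = Fin.append p.1 p.2 := by
  rw [eq_append_iff]
  constructor
  · ext i
    simp [appendCLM, frontHalf]
  · ext i
    simp [appendCLM, backHalf]

/-- The first coordinates of a concatenation, as a continuous linear map. -/
def frontCLM (n m : ℕ) : (Fin (n + m) → ℝ) →L[ℝ] (Fin n → ℝ) :=
  ContinuousLinearMap.pi fun i => ContinuousLinearMap.proj (Fin.castAdd m i)

/-- The last coordinates of a concatenation, as a continuous linear map. -/
def backCLM (n m : ℕ) : (Fin (n + m) → ℝ) →L[ℝ] (Fin m → ℝ) :=
  ContinuousLinearMap.pi fun i => ContinuousLinearMap.proj (Fin.natAdd n i)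

theorem frontCLM_apply {n m : ℕ} (z : Fin (n + m) → ℝ) : frontCLM n m z = frontHalf z := rfl
theorem backCLM_apply {n m : ℕ} (z : Fin (n + m) → ℝ) : backCLM n m z = backHalf z := rfl

theorem ContinuousLinearMap.isLocAnalytic {E F : Type*} [NormedAddCommGroup E] [NormedSpace ℝ E]
    [NormedAddCommGroup F] [NormedSpace ℝ F] (L : E →L[ℝ] F) (S : Set E) : IsLocAnalytic S L :=
  AnalyticOnNhd.isLocAnalytic fun x _ => L.analyticAt x

theorem IsLocAnalytic.append {E : Type*} [NormedAddCommGroup E] [NormedSpace ℝ E] {S : Set E}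
    {n m : ℕ} {f : E → Fin n → ℝ} {g : E → Fin m → ℝ} (hf : IsLocAnalytic S f)
    (hg : IsLocAnalytic S g) : IsLocAnalytic S fun x => Fin.append (f x) (g x) :=
  (((appendCLM n m).isLocAnalytic univ).comp (hf.prodMk hg) (mapsTo_univ _ _)).congr
    fun _ _ => appendCLM_apply _

theorem IsLocAnalytic.pi {E ι : Type*} [Fintype ι] [NormedAddCommGroup E] [NormedSpace ℝ E]
    {S : Set E} {f : E → ι → ℝ} (hf : ∀ i, IsLocAnalytic S fun x => f x i) :
    IsLocAnalytic S f := by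
  intro x hx
  have h := fun i => hf i x hx
  choose g hg hgf using h
  refine ⟨fun y i => g i y, AnalyticAt.pi hg, ?_⟩
  filter_upwards [Filter.eventually_all.2 hgf] with y hy hyS
  exact funext fun i => hy i hyS

theorem IsLocAnalytic.apply {E ι : Type*} [Fintype ι] [NormedAddCommGroup E] [NormedSpace ℝ E]
    {S : Set E} {f : E → ι → ℝ} (hf : IsLocAnalytic S f) (i : ι) :
    IsLocAnalytic S fun x => f x i :=
  ((ContinuousLinearMap.proj (R := ℝ) (φ := fun _ : ι => ℝ) i).isLocAnalytic univ).comp hf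
    (mapsTo_univ _ _)

end Graphs

/-- The analytic group underlying an affine Nash group. -/
def NashGroup.toAnalyticGroup (G : NashGroup) : AnalyticGroup (Fin G.n → ℝ) where
  carrier := G.carrier
  one := G.one
  mul := G.mul
  inv := G.inv
  one_mem := G.one_mem
  mul_mem := G.mul_mem
  inv_mem := G.inv_mem
  mul_assoc := G.mul_assoc
  one_mul := G.one_mul
  inv_mul_cancel := G.inv_mul_cancel
  mul_analytic := by
    refine ((locAnalyticOn_iff_isLocAnalytic.1 G.mul_nash.1).comp
      ((appendCLM G.n G.n).isLocAnalytic _) ?_).congr ?_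
    · rintro p hp
      simpa [appendCLM_apply, frontHalf_append, backHalf_append] using hp
    · rintro p -
      simp only [appendCLM_apply, frontHalf_append, backHalf_append]
  inv_analytic := locAnalyticOn_iff_isLocAnalytic.1 G.inv_nash.1

theorem NashGroup.exists_locally_closed_point (G : NashGroup) :
    ∃ x ∈ G.carrier, ∃ U, IsOpen U ∧ x ∈ U ∧ ∃ Z, IsClosed Z ∧ G.carrier ∩ U = Z ∩ U :=
  G.semialg.isSignDetermined.exists_locally_closed_point ⟨_, G.one_mem⟩

theorem IsNashHomOn.isAnalyticHom {G Q : NashGroup} {π : (Fin G.n → ℝ) → (Fin Q.n → ℝ)}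
    (h : IsNashHomOn G G.carrier Q π) : IsAnalyticHom G.toAnalyticGroup Q.toAnalyticGroup π where
  mapsTo := h.mapsTo
  map_mul := h.map_mul
  analytic := locAnalyticOn_iff_isLocAnalytic.1 h.nash.1

section ProdImage

variable {E : Type*} [NormedAddCommGroup E] [NormedSpace ℝ E] {n₁ n₂ : ℕ}
  {G : AnalyticGroup E} {Q₁ : AnalyticGroup (Fin n₁ → ℝ)} {Q₂ : AnalyticGroup (Fin n₂ → ℝ)}
  {π₁ : E → Fin n₁ → ℝ} {π₂ : E → Fin n₂ → ℝ}

/-- The image of an analytic group under a pair of homomorphisms. -/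
def AnalyticGroup.prodImage (h₁ : IsAnalyticHom G Q₁ π₁) (h₂ : IsAnalyticHom G Q₂ π₂) :
    AnalyticGroup (Fin (n₁ + n₂) → ℝ) where
  carrier := (fun x => Fin.append (π₁ x) (π₂ x)) '' G.carrier
  one := Fin.append Q₁.one Q₂.one
  mul z w := Fin.append (Q₁.mul (frontHalf z) (frontHalf w)) (Q₂.mul (backHalf z) (backHalf w))
  inv z := Fin.append (Q₁.inv (frontHalf z)) (Q₂.inv (backHalf z))
  one_mem := ⟨G.one, G.one_mem, by simp only [h₁.map_one, h₂.map_one]⟩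
  mul_mem := by
    rintro _ ⟨x, hx, rfl⟩ _ ⟨y, hy, rfl⟩
    refine ⟨_, G.mul_mem x hx y hy, ?_⟩
    simp only [frontHalf_append, backHalf_append, h₁.map_mul x hx y hy, h₂.map_mul x hx y hy]
  inv_mem := by
    rintro _ ⟨x, hx, rfl⟩
    refine ⟨_, G.inv_mem x hx, ?_⟩
    simp only [frontHalf_append, backHalf_append, h₁.map_inv hx, h₂.map_inv hx]
  mul_assoc := by
    rintro _ ⟨x, hx, rfl⟩ _ ⟨y, hy, rfl⟩ _ ⟨z, hz, rfl⟩
    simp only [frontHalf_append, backHalf_append]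
    rw [Q₁.mul_assoc _ (h₁.mapsTo hx) _ (h₁.mapsTo hy) _ (h₁.mapsTo hz),
      Q₂.mul_assoc _ (h₂.mapsTo hx) _ (h₂.mapsTo hy) _ (h₂.mapsTo hz)]
  one_mul := by
    rintro _ ⟨x, hx, rfl⟩
    simp only [frontHalf_append, backHalf_append]
    rw [Q₁.one_mul _ (h₁.mapsTo hx), Q₂.one_mul _ (h₂.mapsTo hx)]
  inv_mul_cancel := by
    rintro _ ⟨x, hx, rfl⟩
    simp only [frontHalf_append, backHalf_append]
    rw [Q₁.inv_mul_cancel _ (h₁.mapsTo hx), Q₂.inv_mul_cancel _ (h₂.mapsTo hx)]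
  mul_analytic := by
    have hf := ((frontCLM n₁ n₂ ∘L ContinuousLinearMap.fst ℝ _ _).prod
      (frontCLM n₁ n₂ ∘L ContinuousLinearMap.snd ℝ _ _)).isLocAnalytic
      (((fun x => Fin.append (π₁ x) (π₂ x)) '' G.carrier) ×ˢ
        ((fun x => Fin.append (π₁ x) (π₂ x)) '' G.carrier))
    have hb := ((backCLM n₁ n₂ ∘L ContinuousLinearMap.fst ℝ _ _).prod
      (backCLM n₁ n₂ ∘L ContinuousLinearMap.snd ℝ _ _)).isLocAnalytic
      (((fun x => Fin.append (π₁ x) (π₂ x)) '' G.carrier) ×ˢ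
        ((fun x => Fin.append (π₁ x) (π₂ x)) '' G.carrier))
    refine (Q₁.mul_analytic.comp hf ?_).append (Q₂.mul_analytic.comp hb ?_)
    · rintro ⟨_, _⟩ ⟨⟨x, hx, rfl⟩, ⟨y, hy, rfl⟩⟩
      simp only [ContinuousLinearMap.prod_apply, ContinuousLinearMap.comp_apply,
        ContinuousLinearMap.coe_fst', ContinuousLinearMap.coe_snd', frontCLM_apply,
        frontHalf_append]
      exact ⟨h₁.mapsTo hx, h₁.mapsTo hy⟩
    · rintro ⟨_, _⟩ ⟨⟨x, hx, rfl⟩, ⟨y, hy, rfl⟩⟩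
      simp only [ContinuousLinearMap.prod_apply, ContinuousLinearMap.comp_apply,
        ContinuousLinearMap.coe_fst', ContinuousLinearMap.coe_snd', backCLM_apply,
        backHalf_append]
      exact ⟨h₂.mapsTo hx, h₂.mapsTo hy⟩
  inv_analytic := by
    refine (Q₁.inv_analytic.comp ((frontCLM n₁ n₂).isLocAnalytic _) ?_).append
      (Q₂.inv_analytic.comp ((backCLM n₁ n₂).isLocAnalytic _) ?_)
    · rintro _ ⟨x, hx, rfl⟩
      simp only [frontCLM_apply, frontHalf_append]
      exact h₁.mapsTo hx
    · rintro _ ⟨x, hx, rfl⟩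
      simp only [backHalf_append]
      exact h₂.mapsTo hx

theorem IsAnalyticHom.prodImage (h₁ : IsAnalyticHom G Q₁ π₁) (h₂ : IsAnalyticHom G Q₂ π₂) :
    IsAnalyticHom G (AnalyticGroup.prodImage h₁ h₂) fun x => Fin.append (π₁ x) (π₂ x) where
  mapsTo x hx := ⟨x, hx, rfl⟩
  map_mul x hx y hy := by
    simp only [AnalyticGroup.prodImage, frontHalf_append, backHalf_append,
      h₁.map_mul x hx y hy, h₂.map_mul x hx y hy]
  analytic := h₁.analytic.append h₂.analytic

end ProdImage

section BlockDiagonal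

/-- The block diagonal matrix with two given square blocks, indexed by `Fin`. -/
def blockDiag {m₁ m₂ : ℕ} (A : Matrix (Fin m₁) (Fin m₁) ℝ) (B : Matrix (Fin m₂) (Fin m₂) ℝ) :
    Matrix (Fin (m₁ + m₂)) (Fin (m₁ + m₂)) ℝ :=
  Matrix.reindexAlgEquiv ℝ ℝ finSumFinEquiv (Matrix.fromBlocks A 0 0 B)

theorem blockDiag_mul {m₁ m₂ : ℕ} (A A' : Matrix (Fin m₁) (Fin m₁) ℝ)
    (B B' : Matrix (Fin m₂) (Fin m₂) ℝ) :
    blockDiag (A * A') (B * B') = blockDiag A B * blockDiag A' B' := by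
  simp only [blockDiag, ← map_mul, Matrix.fromBlocks_multiply]
  simp

theorem blockDiag_eq_one_iff {m₁ m₂ : ℕ} {A : Matrix (Fin m₁) (Fin m₁) ℝ}
    {B : Matrix (Fin m₂) (Fin m₂) ℝ} : blockDiag A B = 1 ↔ A = 1 ∧ B = 1 := by
  rw [blockDiag, map_eq_one_iff _ (AlgEquiv.injective _), ← Matrix.fromBlocks_one,
    Matrix.fromBlocks_inj]
  simp

theorem isUnit_blockDiag {m₁ m₂ : ℕ} {A : Matrix (Fin m₁) (Fin m₁) ℝ}
    {B : Matrix (Fin m₂) (Fin m₂) ℝ} (hA : IsUnit A) (hB : IsUnit B) :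
    IsUnit (blockDiag A B) := by
  refine IsUnit.map (Matrix.reindexAlgEquiv ℝ ℝ finSumFinEquiv) ?_
  rw [Matrix.isUnit_iff_isUnit_det, Matrix.det_fromBlocks_zero₂₁]
  exact ((Matrix.isUnit_iff_isUnit_det _).1 hA).mul ((Matrix.isUnit_iff_isUnit_det _).1 hB)

variable {m₁ m₂ : ℕ} (A : Matrix (Fin m₁) (Fin m₁) ℝ) (B : Matrix (Fin m₂) (Fin m₂) ℝ)

@[simp]
theorem blockDiag_castAdd_castAdd (i j : Fin m₁) :
    blockDiag A B (Fin.castAdd m₂ i) (Fin.castAdd m₂ j) = A i j := by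
  simp [blockDiag]

@[simp]
theorem blockDiag_castAdd_natAdd (i : Fin m₁) (j : Fin m₂) :
    blockDiag A B (Fin.castAdd m₂ i) (Fin.natAdd m₁ j) = 0 := by
  simp [blockDiag]

@[simp]
theorem blockDiag_natAdd_castAdd (i : Fin m₂) (j : Fin m₁) :
    blockDiag A B (Fin.natAdd m₁ i) (Fin.castAdd m₂ j) = 0 := by
  simp [blockDiag]

@[simp]
theorem blockDiag_natAdd_natAdd (i j : Fin m₂) :
    blockDiag A B (Fin.natAdd m₁ i) (Fin.natAdd m₁ j) = B i j := by
  simp [blockDiag]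

theorem eq_blockDiag_iff {M : Matrix (Fin (m₁ + m₂)) (Fin (m₁ + m₂)) ℝ} :
    M = blockDiag A B ↔
      (∀ i j, M (Fin.castAdd m₂ i) (Fin.castAdd m₂ j) = A i j) ∧
      (∀ i j, M (Fin.natAdd m₁ i) (Fin.natAdd m₁ j) = B i j) ∧
      (∀ i j, M (Fin.castAdd m₂ i) (Fin.natAdd m₁ j) = 0) ∧
      (∀ i j, M (Fin.natAdd m₁ i) (Fin.castAdd m₂ j) = 0) := by
  constructor
  · rintro rfl
    refine ⟨?_, ?_, ?_, ?_⟩ <;> intro i j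
    · exact blockDiag_castAdd_castAdd A B i j
    · exact blockDiag_natAdd_natAdd A B i j
    · exact blockDiag_castAdd_natAdd A B i j
    · exact blockDiag_natAdd_castAdd A B i j
  · rintro ⟨h1, h2, h3, h4⟩
    ext i j
    refine Fin.addCases (fun i => ?_) (fun i => ?_) i <;>
      refine Fin.addCases (fun j => ?_) (fun j => ?_) j
    · rw [h1, blockDiag_castAdd_castAdd]
    · rw [h3, blockDiag_castAdd_natAdd]
    · rw [h4, blockDiag_natAdd_castAdd]
    · rw [h2, blockDiag_natAdd_natAdd]

theorem eq_matFlatten_iff {m : ℕ} {v : Fin (m * m) → ℝ} {M : Matrix (Fin m) (Fin m) ℝ} :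
    v = matFlatten M ↔ Matrix.of (fun i j => v (finProdFinEquiv (i, j))) = M := by
  constructor
  · rintro rfl
    ext i j
    simp [matFlatten]
  · rintro rfl
    ext k
    exact (congrArg v (finProdFinEquiv.apply_symm_apply k)).symm

theorem isLocAnalytic_matFlatten_blockDiag {E : Type*} [NormedAddCommGroup E] [NormedSpace ℝ E]
    {S : Set E} {f₁ : E → Matrix (Fin m₁) (Fin m₁) ℝ} {f₂ : E → Matrix (Fin m₂) (Fin m₂) ℝ}
    (h₁ : IsLocAnalytic S fun x => matFlatten (f₁ x))
    (h₂ : IsLocAnalytic S fun x => matFlatten (f₂ x)) :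
    IsLocAnalytic S fun x => matFlatten (blockDiag (f₁ x) (f₂ x)) := by
  have h0 : IsLocAnalytic S fun _ : E => (0 : ℝ) :=
    AnalyticOnNhd.isLocAnalytic fun _ _ => analyticAt_const
  have key : ∀ i j, IsLocAnalytic S fun x => blockDiag (f₁ x) (f₂ x) i j := by
    intro i j
    refine Fin.addCases (fun i => ?_) (fun i => ?_) i <;>
      refine Fin.addCases (fun j => ?_) (fun j => ?_) j
    · refine (h₁.apply (finProdFinEquiv (i, j))).congr fun x _ => ?_
      simp [matFlatten]
    · simpa using h0
    · simpa using h0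
    · refine (h₂.apply (finProdFinEquiv (i, j))).congr fun x _ => ?_
      simp [matFlatten]
  exact IsLocAnalytic.pi fun k => key _ _

theorem isSignDetermined_matFlatten_blockDiag {n₁ n₂ : ℕ} {S₁ : Set (Fin n₁ → ℝ)}
    {S₂ : Set (Fin n₂ → ℝ)} {f₁ : (Fin n₁ → ℝ) → Matrix (Fin m₁) (Fin m₁) ℝ}
    {f₂ : (Fin n₂ → ℝ) → Matrix (Fin m₂) (Fin m₂) ℝ}
    (h₁ : IsSemialgebraic (NashGraph S₁ fun x => matFlatten (f₁ x)))
    (h₂ : IsSemialgebraic (NashGraph S₂ fun x => matFlatten (f₂ x)))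
    {σ : Type*} (a₁ : Fin n₁ → σ) (a₂ : Fin n₂ → σ)
    (b : Fin ((m₁ + m₂) * (m₁ + m₂)) → σ) :
    IsSignDetermined {w : σ → ℝ | (w ∘ a₁ ∈ S₁ ∧ w ∘ a₂ ∈ S₂) ∧
      w ∘ b = matFlatten (blockDiag (f₁ (w ∘ a₁)) (f₂ (w ∘ a₂)))} := by
  have t1 := isSignDetermined_of_nashGraph h₁ a₁ fun k =>
    b (finProdFinEquiv (Fin.castAdd m₂ (finProdFinEquiv.symm k).1,
      Fin.castAdd m₂ (finProdFinEquiv.symm k).2))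
  have t2 := isSignDetermined_of_nashGraph h₂ a₂ fun k =>
    b (finProdFinEquiv (Fin.natAdd m₁ (finProdFinEquiv.symm k).1,
      Fin.natAdd m₁ (finProdFinEquiv.symm k).2))
  have t3 := isSignDetermined_comp_eq_const (σ := σ) (fun p : Fin m₁ × Fin m₂ =>
    b (finProdFinEquiv (Fin.castAdd m₂ p.1, Fin.natAdd m₁ p.2))) 0
  have t4 := isSignDetermined_comp_eq_const (σ := σ) (fun p : Fin m₂ × Fin m₁ =>
    b (finProdFinEquiv (Fin.natAdd m₁ p.1, Fin.castAdd m₂ p.2))) 0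
  convert (t1.inter t2).inter (t3.inter t4) using 1
  ext w
  simp only [mem_inter_iff, mem_ofPred_eq, eq_matFlatten_iff, eq_blockDiag_iff]
  simp only [← Matrix.ext_iff, Matrix.of_apply, Function.comp_apply, Equiv.symm_apply_apply,
    funext_iff, Prod.forall,
    Pi.zero_apply]
  tauto

end BlockDiagonal

section NashProdImage

variable {G Q₁ Q₂ : NashGroup} {π₁ : (Fin G.n → ℝ) → (Fin Q₁.n → ℝ)}
  {π₂ : (Fin G.n → ℝ) → (Fin Q₂.n → ℝ)}

theorem isSignDetermined_graph_append (h₁ : IsNashHomOn G G.carrier Q₁ π₁)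
    (h₂ : IsNashHomOn G G.carrier Q₂ π₂) {σ : Type*} (a : Fin G.n → σ)
    (b : Fin (Q₁.n + Q₂.n) → σ) :
    IsSignDetermined {w : σ → ℝ | w ∘ a ∈ G.carrier ∧
      w ∘ b = Fin.append (π₁ (w ∘ a)) (π₂ (w ∘ a))} := by
  convert (isSignDetermined_of_nashGraph h₁.nash.2 a (b ∘ Fin.castAdd Q₂.n)).inter
    (isSignDetermined_of_nashGraph h₂.nash.2 a (b ∘ Fin.natAdd Q₁.n)) using 1
  ext w
  simp only [mem_inter_iff, mem_ofPred_eq, eq_append_iff, ← Function.comp_assoc]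
  exact and_and_left

theorem isSignDetermined_image_append (h₁ : IsNashHomOn G G.carrier Q₁ π₁)
    (h₂ : IsNashHomOn G G.carrier Q₂ π₂) :
    IsSignDetermined ((fun x => Fin.append (π₁ x) (π₂ x)) '' G.carrier) :=
  IsSignDetermined.image_of_graph (isSignDetermined_graph_append h₁ h₂ Sum.inl Sum.inr)

theorem halves_mem_of_mem_image_append (h₁ : IsNashHomOn G G.carrier Q₁ π₁)
    (h₂ : IsNashHomOn G G.carrier Q₂ π₂) {z : Fin (Q₁.n + Q₂.n) → ℝ}
    (hz : z ∈ (fun x => Fin.append (π₁ x) (π₂ x)) '' G.carrier) :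
    frontHalf z ∈ Q₁.carrier ∧ backHalf z ∈ Q₂.carrier := by
  obtain ⟨x, hx, rfl⟩ := hz
  simp only [frontHalf_append, backHalf_append]
  exact ⟨h₁.mapsTo x hx, h₂.mapsTo x hx⟩

theorem exists_isAnalyticSubmanifold_image_append (h₁ : IsNashHomOn G G.carrier Q₁ π₁)
    (h₂ : IsNashHomOn G G.carrier Q₂ π₂) :
    ∃ d, IsAnalyticSubmanifold d ((fun x => Fin.append (π₁ x) (π₂ x)) '' G.carrier) :=
  (h₁.isAnalyticHom.prodImage h₂.isAnalyticHom).isAnalyticSubmanifold (surjOn_image _ _)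
    G.exists_locally_closed_point
    ((isSignDetermined_image_append h₁ h₂).exists_locally_closed_point
      ⟨_, (AnalyticGroup.prodImage h₁.isAnalyticHom h₂.isAnalyticHom).one_mem⟩)
    fun _ hx => G.submanifold.exists_isRetractionAt hx

/-- The image of an affine Nash group under a pair of Nash homomorphisms. -/
noncomputable def NashGroup.prodImage (h₁ : IsNashHomOn G G.carrier Q₁ π₁)
    (h₂ : IsNashHomOn G G.carrier Q₂ π₂) : NashGroup where
  n := Q₁.n + Q₂.n
  dim := (exists_isAnalyticSubmanifold_image_append h₁ h₂).choose
  carrier := (fun x => Fin.append (π₁ x) (π₂ x)) '' G.carrier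
  semialg := (isSignDetermined_image_append h₁ h₂).isSemialgebraic
  submanifold := (exists_isAnalyticSubmanifold_image_append h₁ h₂).choose_spec
  one := Fin.append Q₁.one Q₂.one
  mul z w := Fin.append (Q₁.mul (frontHalf z) (frontHalf w)) (Q₂.mul (backHalf z) (backHalf w))
  inv z := Fin.append (Q₁.inv (frontHalf z)) (Q₂.inv (backHalf z))
  one_mem := (AnalyticGroup.prodImage h₁.isAnalyticHom h₂.isAnalyticHom).one_mem
  mul_mem := (AnalyticGroup.prodImage h₁.isAnalyticHom h₂.isAnalyticHom).mul_mem
  inv_mem := (AnalyticGroup.prodImage h₁.isAnalyticHom h₂.isAnalyticHom).inv_mem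
  mul_assoc := (AnalyticGroup.prodImage h₁.isAnalyticHom h₂.isAnalyticHom).mul_assoc
  one_mul := (AnalyticGroup.prodImage h₁.isAnalyticHom h₂.isAnalyticHom).one_mul
  mul_one := by
    rintro _ ⟨x, hx, rfl⟩
    simp only [frontHalf_append, backHalf_append]
    rw [Q₁.mul_one _ (h₁.mapsTo x hx), Q₂.mul_one _ (h₂.mapsTo x hx)]
  inv_mul_cancel := (AnalyticGroup.prodImage h₁.isAnalyticHom h₂.isAnalyticHom).inv_mul_cancel
  mul_nash := by
    constructor
    · refine locAnalyticOn_iff_isLocAnalytic.2 ?_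
      exact (AnalyticGroup.prodImage h₁.isAnalyticHom h₂.isAnalyticHom).mul_analytic.comp
        (((frontCLM _ _).prod (backCLM _ _)).isLocAnalytic _) fun z hz => hz
    · have hS := isSignDetermined_image_append h₁ h₂
      let a : Fin (Q₁.n + Q₂.n) → Fin (Q₁.n + Q₂.n + (Q₁.n + Q₂.n) + (Q₁.n + Q₂.n)) :=
        fun i => Fin.castAdd _ (Fin.castAdd _ i)
      let b : Fin (Q₁.n + Q₂.n) → Fin (Q₁.n + Q₂.n + (Q₁.n + Q₂.n) + (Q₁.n + Q₂.n)) :=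
        fun i => Fin.castAdd _ (Fin.natAdd _ i)
      let c : Fin (Q₁.n + Q₂.n) → Fin (Q₁.n + Q₂.n + (Q₁.n + Q₂.n) + (Q₁.n + Q₂.n)) :=
        fun i => Fin.natAdd _ i
      refine isSemialgebraic_nashGraph_of (((hS.preimage_comp a).inter (hS.preimage_comp b)).inter
        ((Q₁.isSignDetermined_mul (a ∘ Fin.castAdd _) (b ∘ Fin.castAdd _) (c ∘ Fin.castAdd _)).inter
          (Q₂.isSignDetermined_mul (a ∘ Fin.natAdd _) (b ∘ Fin.natAdd _) (c ∘ Fin.natAdd _)))) ?_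
      intro w
      have hf := fun v => halves_mem_of_mem_image_append h₁ h₂ (z := v)
      simp only [mem_inter_iff, mem_ofPred_eq, eq_append_iff, ← Function.comp_assoc]
      constructor
      · rintro ⟨⟨ha, hb⟩, ⟨-, h1⟩, -, h2⟩
        exact ⟨⟨ha, hb⟩, h1, h2⟩
      · rintro ⟨⟨ha, hb⟩, h1, h2⟩
        exact ⟨⟨ha, hb⟩, ⟨⟨(hf _ ha).1, (hf _ hb).1⟩, h1⟩, ⟨(hf _ ha).2, (hf _ hb).2⟩, h2⟩
  inv_nash := by
    constructor
    · exact locAnalyticOn_iff_isLocAnalytic.2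
        (AnalyticGroup.prodImage h₁.isAnalyticHom h₂.isAnalyticHom).inv_analytic
    · have hS := isSignDetermined_image_append h₁ h₂
      let a : Fin (Q₁.n + Q₂.n) → Fin (Q₁.n + Q₂.n + (Q₁.n + Q₂.n)) := Fin.castAdd _
      let c : Fin (Q₁.n + Q₂.n) → Fin (Q₁.n + Q₂.n + (Q₁.n + Q₂.n)) := Fin.natAdd _
      refine isSemialgebraic_nashGraph_of ((hS.preimage_comp a).inter
        ((isSignDetermined_of_nashGraph Q₁.inv_nash.2 (a ∘ Fin.castAdd _) (c ∘ Fin.castAdd _)).inter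
          (isSignDetermined_of_nashGraph Q₂.inv_nash.2 (a ∘ Fin.natAdd _) (c ∘ Fin.natAdd _)))) ?_
      intro w
      have hf := fun v => halves_mem_of_mem_image_append h₁ h₂ (z := v)
      simp only [mem_inter_iff, mem_ofPred_eq, eq_append_iff, ← Function.comp_assoc]
      constructor
      · rintro ⟨ha, ⟨-, h1⟩, -, h2⟩
        exact ⟨ha, h1, h2⟩
      · rintro ⟨ha, h1, h2⟩
        exact ⟨ha, ⟨(hf _ ha).1, h1⟩, (hf _ ha).2, h2⟩

theorem IsNashHomOn.prodImage (h₁ : IsNashHomOn G G.carrier Q₁ π₁)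
    (h₂ : IsNashHomOn G G.carrier Q₂ π₂) :
    IsNashHomOn G G.carrier (NashGroup.prodImage h₁ h₂) fun x => Fin.append (π₁ x) (π₂ x) where
  mapsTo := (h₁.isAnalyticHom.prodImage h₂.isAnalyticHom).mapsTo
  map_mul := (h₁.isAnalyticHom.prodImage h₂.isAnalyticHom).map_mul
  nash := ⟨locAnalyticOn_iff_isLocAnalytic.2
    (h₁.isAnalyticHom.prodImage h₂.isAnalyticHom).analytic,
    isSemialgebraic_nashGraph_of (isSignDetermined_graph_append h₁ h₂ _ _) fun _ => Iff.rfl⟩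

theorem NashGroup.AlmostLinear.prodImage (h₁ : IsNashHomOn G G.carrier Q₁ π₁)
    (h₂ : IsNashHomOn G G.carrier Q₂ π₂) (a₁ : Q₁.AlmostLinear) (a₂ : Q₂.AlmostLinear) :
    (NashGroup.prodImage h₁ h₂).AlmostLinear := by
  obtain ⟨m₁, f₁, hf₁, hu₁, hm₁, hk₁⟩ := a₁
  obtain ⟨m₂, f₂, hf₂, hu₂, hm₂, hk₂⟩ := a₂
  have hfront := fun z hz => (halves_mem_of_mem_image_append h₁ h₂ (z := z) hz).1
  have hback := fun z hz => (halves_mem_of_mem_image_append h₁ h₂ (z := z) hz).2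
  refine ⟨m₁ + m₂, fun z => blockDiag (f₁ (frontHalf z)) (f₂ (backHalf z)), ⟨?_, ?_⟩, ?_, ?_, ?_⟩
  · refine locAnalyticOn_iff_isLocAnalytic.2 (isLocAnalytic_matFlatten_blockDiag
      ((locAnalyticOn_iff_isLocAnalytic.1 hf₁.1).comp ((frontCLM _ _).isLocAnalytic _) hfront)
      ((locAnalyticOn_iff_isLocAnalytic.1 hf₂.1).comp ((backCLM _ _).isLocAnalytic _) hback))
  · refine isSemialgebraic_nashGraph_of
      (((isSignDetermined_image_append h₁ h₂).preimage_comp (Fin.castAdd _)).inter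
        (isSignDetermined_matFlatten_blockDiag hf₁.2 hf₂.2 (Fin.castAdd _ ∘ Fin.castAdd _)
          (Fin.castAdd _ ∘ Fin.natAdd _) (Fin.natAdd _))) fun w => ?_
    constructor
    · rintro ⟨h, -, h'⟩
      exact ⟨h, h'⟩
    · rintro ⟨h, h'⟩
      exact ⟨h, ⟨hfront _ h, hback _ h⟩, h'⟩
  · exact fun z hz => isUnit_blockDiag (hu₁ _ (hfront z hz)) (hu₂ _ (hback z hz))
  · intro z hz w hw
    simp only [NashGroup.prodImage, frontHalf_append, backHalf_append]
    rw [← blockDiag_mul, hm₁ _ (hfront z hz) _ (hfront w hw), hm₂ _ (hback z hz) _ (hback w hw)]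
  · refine ((hk₁.prod hk₂).image fun p => Fin.append p.1 p.2).subset ?_
    rintro z ⟨hz, h⟩
    obtain ⟨h1, h2⟩ := blockDiag_eq_one_iff.1 h
    exact ⟨(frontHalf z, backHalf z), ⟨⟨hfront z hz, h1⟩, hback z hz, h2⟩,
      append_frontHalf_backHalf z⟩

end NashProdImage

section Trivial

theorem isSemialgebraic_of_subsingleton {n : ℕ} [Subsingleton (Fin n → ℝ)]
    (S : Set (Fin n → ℝ)) : IsSemialgebraic S :=
  IsSignDetermined.isSemialgebraic ⟨∅, fun x y _ hx => Subsingleton.elim x y ▸ hx⟩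

theorem isNashMapOn_of_subsingleton {n m : ℕ} [Subsingleton (Fin m → ℝ)] {S : Set (Fin n → ℝ)}
    (hS : IsSemialgebraic S) (f : (Fin n → ℝ) → (Fin m → ℝ)) : IsNashMapOn S f := by
  constructor
  · exact fun x _ => ⟨univ, isOpen_univ, mem_univ x, fun _ => 0, fun _ _ => analyticAt_const,
      fun _ _ => Subsingleton.elim _ _⟩
  · exact isSemialgebraic_nashGraph_of (hS.isSignDetermined.preimage_comp _)
      fun w => ⟨fun h => ⟨h, Subsingleton.elim _ _⟩, fun h => h.1⟩

/-- The trivial affine Nash group. -/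
def NashGroup.trivial : NashGroup where
  n := 0
  dim := 0
  carrier := univ
  semialg := isSemialgebraic_of_subsingleton _
  submanifold x _ := ⟨univ, univ, id, id, isOpen_univ, isOpen_univ, mem_univ _,
    analyticOnNhd_id, analyticOnNhd_id, fun _ _ => mem_univ _, fun _ _ => mem_univ _,
    fun _ _ => rfl, fun _ _ => rfl, by ext; simp⟩
  one := 0
  mul _ _ := 0
  inv _ := 0
  one_mem := mem_univ _
  mul_mem _ _ _ _ := mem_univ _
  inv_mem _ _ := mem_univ _
  mul_assoc _ _ _ _ _ _ := rfl
  one_mul _ _ := Subsingleton.elim _ _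
  mul_one _ _ := Subsingleton.elim _ _
  inv_mul_cancel _ _ := rfl
  mul_nash := isNashMapOn_of_subsingleton
    (have : Subsingleton (Fin (0 + 0) → ℝ) := inferInstanceAs (Subsingleton (Fin 0 → ℝ))
    isSemialgebraic_of_subsingleton _) _
  inv_nash := isNashMapOn_of_subsingleton (isSemialgebraic_of_subsingleton _) _

theorem NashGroup.trivial_almostLinear : NashGroup.trivial.AlmostLinear := by
  have : Subsingleton (Fin (0 * 0) → ℝ) := inferInstanceAs (Subsingleton (Fin 0 → ℝ))
  have : Subsingleton (Fin NashGroup.trivial.n → ℝ) :=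
    inferInstanceAs (Subsingleton (Fin 0 → ℝ))
  exact ⟨0, fun _ => 1, isNashMapOn_of_subsingleton NashGroup.trivial.semialg _,
    fun _ _ => isUnit_one, fun _ _ _ _ => (_root_.mul_one _).symm, Set.toFinite _⟩

theorem hasAlmostLinearQuotientBy_carrier (G : NashGroup) :
    HasAlmostLinearQuotientBy G G.carrier := by
  have : Subsingleton (Fin NashGroup.trivial.n → ℝ) :=
    inferInstanceAs (Subsingleton (Fin 0 → ℝ))
  refine ⟨NashGroup.trivial, fun _ => NashGroup.trivial.one,
    ⟨fun _ _ => mem_univ _, fun _ _ _ _ => rfl, isNashMapOn_of_subsingleton G.semialg _⟩, ?_, ?_,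
    NashGroup.trivial_almostLinear⟩
  · exact eq_univ_of_forall fun _ => ⟨G.one, G.one_mem, Subsingleton.elim _ _⟩
  · ext x
    simp

end Trivial

section Final

open Filter Module

theorem IsNashSubgroup.inter {G : NashGroup} {H K : Set (Fin G.n → ℝ)} (hH : IsNashSubgroup G H)
    (hK : IsNashSubgroup G K) : IsNashSubgroup G (H ∩ K) where
  subset _ hx := hH.subset hx.1
  one_mem := ⟨hH.one_mem, hK.one_mem⟩
  mul_mem x hx y hy := ⟨hH.mul_mem x hx.1 y hy.1, hK.mul_mem x hx.2 y hy.2⟩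
  inv_mem x hx := ⟨hH.inv_mem x hx.1, hK.inv_mem x hx.2⟩
  semialg := (hH.semialg.isSignDetermined.inter hK.semialg.isSignDetermined).isSemialgebraic

theorem NashGroup.isNashSubgroup_carrier (G : NashGroup) : IsNashSubgroup G G.carrier :=
  ⟨subset_rfl, G.one_mem, G.mul_mem, G.inv_mem, G.semialg⟩

theorem HasAlmostLinearQuotientBy.inter {G : NashGroup} {H K : Set (Fin G.n → ℝ)}
    (hH : HasAlmostLinearQuotientBy G H) (hK : HasAlmostLinearQuotientBy G K) :
    HasAlmostLinearQuotientBy G (H ∩ K) := by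
  obtain ⟨Q₁, π₁, h₁, -, rfl, a₁⟩ := hH
  obtain ⟨Q₂, π₂, h₂, -, rfl, a₂⟩ := hK
  refine ⟨NashGroup.prodImage h₁ h₂, _, h₁.prodImage h₂, rfl, ?_, .prodImage h₁ h₂ a₁ a₂⟩
  ext x
  simp only [NashGroup.prodImage, eq_append_iff, frontHalf_append, backHalf_append,
    mem_inter_iff, mem_ofPred_eq]
  tauto

/-- A preconnected piece of a subgroup `K` which meets a subgroup `N` that is open in `K` is
contained in `N`. -/
theorem subset_of_eventually_mem {G : NashGroup} {K N C : Set (Fin G.n → ℝ)}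
    (hK : IsNashSubgroup G K) (hN : IsNashSubgroup G N) (hCK : C ⊆ K)
    (hC : IsPreconnected C) (hKN : ∀ᶠ y in 𝓝[G.carrier] G.one, y ∈ K → y ∈ N)
    (hne : (C ∩ N).Nonempty) : C ⊆ N := by
  let toG : ∀ x ∈ C, G.toAnalyticGroup.carrier := fun x hx => ⟨x, hK.subset (hCK hx)⟩
  have hP : ∀ x ∈ C, ∀ y ∈ C, G.mul (G.inv x) y ∈ N := by
    intro x hx y hy
    refine hC.induction₂ (fun x y => G.mul (G.inv x) y ∈ N) ?_ ?_ ?_ hx hy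
    · intro x hx
      have hxG := hK.subset (hCK hx)
      have hcont := (G.toAnalyticGroup.mul_left_isLocAnalytic
        (G.inv_mem x hxG)).continuousOn x hxG
      have hmaps : MapsTo (G.mul (G.inv x)) G.carrier G.carrier := fun y hy =>
        G.mul_mem _ (G.inv_mem x hxG) y hy
      have ht : Tendsto (G.mul (G.inv x)) (𝓝[C] x) (𝓝[G.carrier] G.one) := by
        have := hcont.tendsto_nhdsWithin hmaps
        change Tendsto (G.mul (G.inv x)) _ (𝓝[G.carrier] (G.mul (G.inv x) x)) at this
        rw [G.inv_mul_cancel x hxG] at this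
        exact this.mono_left (nhdsWithin_mono _ (hCK.trans hK.subset))
      filter_upwards [ht.eventually hKN, self_mem_nhdsWithin] with y hy hyC
      exact hy (hK.mul_mem _ (hK.inv_mem x (hCK hx)) y (hCK hyC))
    · intro x y z hx hy hz hxy hyz
      have h : (toG x hx)⁻¹ * toG z hz =
          ((toG x hx)⁻¹ * toG y hy) * ((toG y hy)⁻¹ * toG z hz) := by group
      have h' : G.mul (G.inv x) z = G.mul (G.mul (G.inv x) y) (G.mul (G.inv y) z) :=
        congrArg Subtype.val h
      exact h' ▸ hN.mul_mem _ hxy _ hyz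
    · intro x y hx hy hxy
      have h : (toG y hy)⁻¹ * toG x hx = ((toG x hx)⁻¹ * toG y hy)⁻¹ := by group
      have h' : G.mul (G.inv y) x = G.inv (G.mul (G.inv x) y) := congrArg Subtype.val h
      exact h' ▸ hN.inv_mem _ hxy
  obtain ⟨x, hxC, hxN⟩ := hne
  intro y hy
  have h : toG y hy = toG x hxC * ((toG x hxC)⁻¹ * toG y hy) := by group
  have h' : y = G.mul x (G.mul (G.inv x) y) := congrArg Subtype.val h
  have hmem := hN.mul_mem x hxN _ (hP x hxC y hy)
  rwa [← h'] at hmem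

/-- There is an almost linear quotient whose kernel is, near the identity, contained in the kernel
of every other almost linear quotient. -/
theorem exists_locally_smallest (G : NashGroup) :
    ∃ K₀, (HasAlmostLinearQuotientBy G K₀ ∧ IsNashSubgroup G K₀ ∧ IsNormalIn G G.carrier K₀) ∧
      ∀ K, HasAlmostLinearQuotientBy G K ∧ IsNashSubgroup G K ∧ IsNormalIn G G.carrier K →
        ∀ᶠ y in 𝓝[G.carrier] G.one, y ∈ K₀ → y ∈ K := by
  obtain ⟨ρ, hρ⟩ := G.submanifold.exists_isRetractionAt G.one_mem
  let ranks : Set ℕ := {r | ∃ (Q : NashGroup) (π : (Fin G.n → ℝ) → (Fin Q.n → ℝ)),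
    IsNashHomOn G G.carrier Q π ∧ π '' G.carrier = Q.carrier ∧
    (IsNashSubgroup G {x ∈ G.carrier | π x = Q.one} ∧
      IsNormalIn G G.carrier {x ∈ G.carrier | π x = Q.one}) ∧ Q.AlmostLinear ∧
    r = finrank ℝ (fderiv ℝ (fun y => π (ρ y)) G.one).range}
  have hbdd : BddAbove ranks := by
    refine ⟨G.n, ?_⟩
    rintro r ⟨Q, π, -, -, -, -, rfl⟩
    exact (LinearMap.finrank_range_le _).trans (by simp)
  have hne : ranks.Nonempty := by
    obtain ⟨Q, π, h, hs, hk, ha⟩ := hasAlmostLinearQuotientBy_carrier G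
    refine ⟨_, Q, π, h, hs, ?_, ha, rfl⟩
    rw [hk]
    exact ⟨G.isNashSubgroup_carrier, fun g hg x hx =>
      G.mul_mem _ (G.mul_mem g hg x hx) _ (G.inv_mem g hg)⟩
  obtain ⟨Q₀, π₀, h₀, hs₀, hk₀, a₀, hr₀⟩ := Nat.sSup_mem hne hbdd
  refine ⟨_, ⟨⟨Q₀, π₀, h₀, hs₀, rfl, a₀⟩, hk₀⟩, ?_⟩
  rintro K ⟨⟨Q, π, h, hs, rfl, a⟩, hk⟩
  have hker : {x ∈ G.carrier | Fin.append (π₀ x) (π x) = Fin.append Q₀.one Q.one} =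
      {x ∈ G.carrier | π₀ x = Q₀.one} ∩ {x ∈ G.carrier | π x = Q.one} := by
    ext x
    simp only [eq_append_iff, frontHalf_append, backHalf_append, mem_inter_iff, mem_ofPred_eq]
    tauto
  have hmem : finrank ℝ (fderiv ℝ (fun y => Fin.append (π₀ (ρ y)) (π (ρ y))) G.one).range ∈
      ranks := by
    have hkN := hk₀.1.inter hk.1
    have hkn : IsNormalIn G G.carrier ({x ∈ G.carrier | π₀ x = Q₀.one} ∩
        {x ∈ G.carrier | π x = Q.one}) :=
      fun g hg x hx => ⟨hk₀.2 g hg x hx.1, hk.2 g hg x hx.2⟩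
    rw [← hker] at hkN hkn
    exact ⟨NashGroup.prodImage h₀ h, _, h₀.prodImage h, rfl, ⟨hkN, hkn⟩, .prodImage h₀ h a₀ a, rfl⟩
  have hle := le_csSup hbdd hmem
  rw [hr₀] at hle
  have hev := (h₀.isAnalyticHom.prodImage h.isAnalyticHom).eventually_eq_of_finrank_le (π := π₀)
    (frontCLM _ _) (fun x _ => frontHalf_append _ _) hρ hle
  filter_upwards [hev, self_mem_nhdsWithin] with y hy hyG hy0
  refine ⟨hyG, ?_⟩
  have h1 := hy (hy0.2.trans h₀.isAnalyticHom.map_one.symm)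
  have h2 := congrArg backHalf h1
  simp only [backHalf_append] at h2
  exact h2.trans h.isAnalyticHom.map_one

end Final

/-- Every affine Nash group `G` has a smallest normal Nash subgroup `H` such
that some quotient of `G` by `H` is an almost linear affine Nash group. -/
theorem exists_smallest_normal_with_almost_linear_quotient (G : NashGroup) :
    ∃ H : Set (Fin G.n → ℝ),
      IsNashSubgroup G H ∧ IsNormalIn G G.carrier H ∧
      HasAlmostLinearQuotientBy G H ∧
      ∀ K : Set (Fin G.n → ℝ), IsNashSubgroup G K → IsNormalIn G G.carrier K →
        HasAlmostLinearQuotientBy G K → H ⊆ K := by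
  obtain ⟨K₀, hK₀, hmin⟩ := exists_locally_smallest G
  obtain ⟨𝒞, hfin, hcover, hconn⟩ :=
    hK₀.2.1.semialg.isSignDetermined.exists_preconnected_cover
  let F : Set (Set (Fin G.n → ℝ)) := {N | N ⊆ K₀ ∧
    HasAlmostLinearQuotientBy G N ∧ IsNashSubgroup G N ∧ IsNormalIn G G.carrier N}
  let pieces : Set (Fin G.n → ℝ) → Set (Set (Fin G.n → ℝ)) := fun N => {C ∈ 𝒞 | (C ∩ N).Nonempty}
  have hpfin : ∀ N, (pieces N).Finite := fun N => hfin.subset (sep_subset _ _)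
  obtain ⟨N, hN, hNmin⟩ := exists_minimalFor_of_wellFoundedLT (· ∈ F)
    (fun N => (pieces N).ncard) ⟨K₀, subset_rfl, hK₀⟩
  refine ⟨N, hN.2.2.1, hN.2.2.2, hN.2.1, fun K hK hKn hKa x hx => ?_⟩
  have hNK : N ∩ K ∈ F := ⟨fun y hy => hN.1 hy.1, hN.2.1.inter hKa, hN.2.2.1.inter hK,
    fun g hg y hy => ⟨hN.2.2.2 g hg y hy.1, hKn g hg y hy.2⟩⟩
  have hsub : pieces (N ∩ K) ⊆ pieces N := fun C hC =>
    ⟨hC.1, hC.2.mono (inter_subset_inter_right _ inter_subset_left)⟩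
  have heq : pieces (N ∩ K) = pieces N :=
    eq_of_subset_of_ncard_le hsub (hNmin hNK (ncard_le_ncard hsub (hpfin N))) (hpfin N)
  obtain ⟨C, hC, hxC⟩ := hcover.symm.subset (hN.1 hx)
  have hCN : C ∈ pieces (N ∩ K) := heq ▸ ⟨hC, x, hxC, hx⟩
  exact (subset_of_eventually_mem hK₀.2.1 hNK.2.2.1
    ((subset_sUnion_of_mem hC).trans hcover.subset) (hconn C hC) (hmin _ hNK.2) hCN.2 hxC).2
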